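/- arXiv:2302.03966 — 5 statements merged into one kernel-verified Lean document; each statement's English description precedes it below -/
import Mathlib

section
/- Given an integer k ≥ 4 and a constant δ > 2/k, there exist α, β > 0 such that the following holds for all sufficiently large n: if G = (V₁, …, V_k, E) is a spanning subgraph of the n-blow-up of C_k with δ̄(G) ≥ δn and α*_b(G) < αn, then every transversal k-subset of V(G) has at least (βn − k)/(4k²) pairwise vertex-disjoint (C_k, 2k)-absorbers. -/
/-- `A` has a transversal `C_k`-factor in `G`: there are pairwise vertex-disjoint transversal
copies of `C_k` whose vertices cover `A` exactly. -/
def HasTransversalCkFactorOn {k n : ℕ} (G : SimpleGraph (ZMod k × Fin n))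
    (A : Set (ZMod k × Fin n)) : Prop :=
  ∃ (m : ℕ) (c : Fin m → ZMod k → Fin n),
    (∀ (j : Fin m) (i : ZMod k), G.Adj (i, c j i) (i + 1, c j (i + 1))) ∧
    (∀ i : ZMod k, Function.Injective fun j => c j i) ∧
    (∀ i : ZMod k, Set.range (fun j => c j i) = {a : Fin n | (i, a) ∈ A})

open Classical in
/-- Abstract hypotheses on the cyclic family of bipartite graphs. -/
structure NiceRel {k n : ℕ} (R : ZMod k → Fin n → Fin n → Prop) (a M : ℕ) : Prop where
  hole : ∀ i (S T : Finset (Fin n)), a ≤ S.card → a ≤ T.card → ∃ x ∈ S, ∃ y ∈ T, R i x y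
  degp : ∀ i x (F : Finset (Fin n)), F.card ≤ M →
    ∃ S : Finset (Fin n), S.card = a ∧ ∀ b ∈ S, b ∉ F ∧ R i x b
  degm : ∀ i y (F : Finset (Fin n)), F.card ≤ M →
    ∃ S : Finset (Fin n), S.card = a ∧ ∀ b ∈ S, b ∉ F ∧ R i b y
  size : M + 2 * a ≤ n
  apos : 1 ≤ a
  short : k = 4 → ∀ i x y (F : Finset (Fin n)), F.card ≤ M → ∃ b, b ∉ F ∧ R i x b ∧ R (i + 1) b y

namespace NiceRel

variable {k n : ℕ} {R : ZMod k → Fin n → Fin n → Prop} {a M : ℕ}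

open Classical in
theorem badp (h : NiceRel R a M) (i : ZMod k) (S : Finset (Fin n)) (hS : a ≤ S.card) :
    (Finset.univ.filter fun b => ∀ c ∈ S, ¬ R i c b).card < a := by
  by_contra! hc
  obtain ⟨x, hx, y, hy, hR⟩ := h.hole i S _ hS hc
  exact (Finset.mem_filter.1 hy).2 x hx hR

open Classical in
theorem badm (h : NiceRel R a M) (i : ZMod k) (S : Finset (Fin n)) (hS : a ≤ S.card) :
    (Finset.univ.filter fun b => ∀ c ∈ S, ¬ R i b c).card < a := by
  by_contra! hc
  obtain ⟨x, hx, y, hy, hR⟩ := h.hole i _ S hc hS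
  exact (Finset.mem_filter.1 hx).2 y hy hR

open Classical in
theorem reach (h : NiceRel R a M) (i : ZMod k) (x : Fin n) (F : ZMod k → Finset (Fin n))
    (hF : ∀ j, (F j).card ≤ M) (t : ℕ) :
    ∃ S : Finset (Fin n), S.card = a ∧ ∀ b ∈ S, ∃ f : ℕ → Fin n, f 0 = x ∧ f (t + 1) = b ∧
      (∀ u, u < t + 1 → R (i + (u : ℕ)) (f u) (f (u + 1))) ∧
      ∀ u, 0 < u → u ≤ t + 1 → f u ∉ F (i + (u : ℕ)) := by
  induction t with
  | zero =>
    obtain ⟨S, hS, hb⟩ := h.degp i x (F (i + 1)) (hF _)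
    refine ⟨S, hS, fun b hbS => ⟨fun u => if u = 0 then x else b, by simp, by simp, ?_, ?_⟩⟩
    · intro u hu
      obtain rfl : u = 0 := by omega
      simpa using (hb b hbS).2
    · intro u h0 hu
      obtain rfl : u = 1 := by omega
      simpa using (hb b hbS).1
  | succ t ih =>
    obtain ⟨S, hS, hb⟩ := ih
    set Bd := Finset.univ.filter fun b => ∀ c ∈ S, ¬ R (i + ((t + 1 : ℕ) : ZMod k)) c b with hBd
    have h1 : Bd.card < a := h.badp _ S hS.ge
    have h2 : a ≤ (F (i + ((t + 2 : ℕ) : ZMod k)) ∪ Bd)ᶜ.card := by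
      rw [Finset.card_compl, Fintype.card_fin]
      have := Finset.card_union_le (F (i + ((t + 2 : ℕ) : ZMod k))) Bd
      have := hF (i + ((t + 2 : ℕ) : ZMod k))
      have := h.size
      omega
    obtain ⟨T, hT, hTa⟩ := Finset.exists_subset_card_eq h2
    refine ⟨T, hTa, fun b hbT => ?_⟩
    have hb2 := hT hbT
    simp only [Finset.mem_compl, Finset.mem_union, not_or] at hb2
    obtain ⟨hbF, hbB⟩ := hb2
    simp only [hBd, Finset.mem_filter, Finset.mem_univ, true_and, not_forall, not_not] at hbB
    obtain ⟨c, hc, hR⟩ := hbB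
    obtain ⟨f, f0, f1, f2, f3⟩ := hb c hc
    refine ⟨fun u => if u ≤ t + 1 then f u else b, by simpa using f0, by simp, ?_, ?_⟩
    · intro u hu
      by_cases hu' : u < t + 1
      · have e1 : u ≤ t + 1 := by omega
        have e2 : u + 1 ≤ t + 1 := by omega
        simp only [e1, e2, if_true]
        exact f2 u hu'
      · obtain rfl : u = t + 1 := by omega
        simpa [f1] using hR
    · intro u h0 hu
      by_cases hu' : u ≤ t + 1
      · simp only [hu', if_true]
        exact f3 u h0 hu'
      · obtain rfl : u = t + 2 := by omega
        simpa using hbF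

open Classical in
theorem path (h : NiceRel R a M) (hk : 4 ≤ k) (i : ZMod k) (x y : Fin n)
    (F : ZMod k → Finset (Fin n)) (hF : ∀ j, (F j).card ≤ M) :
    ∃ f : ℕ → Fin n, f 0 = x ∧ f (k - 2) = y ∧
      (∀ u, u < k - 2 → R (i + (u : ℕ)) (f u) (f (u + 1))) ∧
      ∀ u, 0 < u → u < k - 2 → f u ∉ F (i + (u : ℕ)) := by
  by_cases h4 : k = 4
  · obtain ⟨b, hbF, hb1, hb2⟩ := h.short h4 i x y (F (i + 1)) (hF _)
    refine ⟨fun u => if u = 0 then x else if u = 1 then b else y, by simp, ?_, ?_, ?_⟩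
    · have e1 : k - 2 ≠ 0 := by omega
      have e2 : k - 2 ≠ 1 := by omega
      simp [e1, e2]
    · intro u hu
      have : u = 0 ∨ u = 1 := by omega
      rcases this with rfl | rfl
      · simpa using hb1
      · simpa using hb2
    · intro u h0 hu
      obtain rfl : u = 1 := by omega
      simpa using hbF
  · obtain ⟨t, rfl⟩ : ∃ t, k = t + 5 := ⟨k - 5, by omega⟩
    obtain ⟨S, hS, hb⟩ := h.reach i x F hF t
    obtain ⟨T, hT, hTb⟩ := h.degm (i + ((t + 2 : ℕ) : ZMod (t + 5))) y
      (F (i + ((t + 2 : ℕ) : ZMod (t + 5)))) (hF _)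
    obtain ⟨c, hc, d, hd, hR⟩ := h.hole (i + ((t + 1 : ℕ) : ZMod (t + 5))) S T hS.ge hT.ge
    obtain ⟨f, f0, f1, f2, f3⟩ := hb c hc
    obtain ⟨hdF, hdy⟩ := hTb d hd
    have ek : t + 5 - 2 = t + 3 := by omega
    rw [ek]
    refine ⟨fun u => if u ≤ t + 1 then f u else if u = t + 2 then d else y, by simpa using f0,
      by simp, ?_, ?_⟩
    · intro u hu
      by_cases hu' : u < t + 1
      · have e1 : u ≤ t + 1 := by omega
        have e2 : u + 1 ≤ t + 1 := by omega
        simp only [e1, e2, if_true]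
        exact f2 u hu'
      · by_cases hu2 : u = t + 1
        · subst hu2
          simpa [f1] using hR
        · obtain rfl : u = t + 2 := by omega
          simpa using hdy
    · intro u h0 hu
      by_cases hu' : u ≤ t + 1
      · simp only [hu', if_true]
        exact f3 u h0 hu'
      · obtain rfl : u = t + 2 := by omega
        simpa using hdF

theorem path' (h : NiceRel R a M) (hk : 4 ≤ k) (i : ZMod k) (v x y : Fin n)
    (hx : R i v x) (hy : R (i - 1) y v)
    (F : ZMod k → Finset (Fin n)) (hF : ∀ j, (F j).card ≤ M) :
    ∃ p : ZMod k → Fin n, p i = v ∧ p (i + 1) = x ∧ p (i - 1) = y ∧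
      (∀ j, R j (p j) (p (j + 1))) ∧
      ∀ j, j ≠ i → j ≠ i + 1 → j ≠ i - 1 → p j ∉ F j := by
  have : NeZero k := ⟨by omega⟩
  obtain ⟨f, f0, f1, f2, f3⟩ := h.path hk (i + 1) x y F hF
  -- value at parameter
  have hrep : ∀ j : ZMod k, ∃ t : ℕ, t < k ∧ j = i + 1 + (t : ZMod k) := fun j =>
    ⟨(j - (i + 1)).val, ZMod.val_lt _, by simp⟩
  let p : ZMod k → Fin n := fun j =>
    if (j - (i + 1)).val < k - 1 then f (j - (i + 1)).val else v
  have pv : ∀ t : ℕ, t < k - 1 → p (i + 1 + (t : ZMod k)) = f t := by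
    intro t ht
    have : (i + 1 + (t : ZMod k) - (i + 1)).val = t := by
      rw [add_sub_cancel_left, ZMod.val_natCast_of_lt (by omega)]
    simp only [p, this, ht, if_true]
  have ei : i + 1 + ((k - 1 : ℕ) : ZMod k) = i := by
    have : ((k - 1 : ℕ) : ZMod k) = -1 := by
      rw [Nat.cast_sub (by omega)]; simp
    rw [this]; ring
  have em : i + 1 + ((k - 2 : ℕ) : ZMod k) = i - 1 := by
    have : ((k - 2 : ℕ) : ZMod k) = -2 := by
      rw [Nat.cast_sub (by omega)]; simp
    rw [this]; ring
  have pi : p i = v := by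
    have : (i - (i + 1)).val = k - 1 := by
      conv_lhs => rw [← ei]
      rw [ei]
      have : i - (i + 1) = ((k - 1 : ℕ) : ZMod k) := by
        rw [Nat.cast_sub (by omega)]; simp
      rw [this, ZMod.val_natCast_of_lt (by omega)]
    simp only [p, this, lt_irrefl, if_false]
  have px : p (i + 1) = x := by
    have := pv 0 (by omega)
    simpa [f0] using this
  have py : p (i - 1) = y := by
    rw [← em, pv _ (by omega), f1]
  refine ⟨p, pi, px, py, ?_, ?_⟩
  · intro j
    obtain ⟨t, ht, rfl⟩ := hrep j
    by_cases h1 : t < k - 2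
    · have e : i + 1 + (t : ZMod k) + 1 = i + 1 + ((t + 1 : ℕ) : ZMod k) := by push_cast; ring
      rw [e, pv t (by omega), pv (t + 1) (by omega)]
      exact f2 t h1
    · by_cases h2 : t = k - 2
      · rw [h2, em, py, sub_add_cancel, pi]; exact hy
      · obtain rfl : t = k - 1 := by omega
        rw [ei, pi, px]; exact hx
  · intro j hj0 hj1 hj2
    obtain ⟨t, ht, rfl⟩ := hrep j
    have t1 : t ≠ k - 1 := by rintro rfl; exact hj0 ei
    have t2 : t ≠ k - 2 := by rintro rfl; exact hj2 em
    have t3 : t ≠ 0 := by rintro rfl; simp at hj1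
    rw [pv t (by omega)]
    exact f3 t (by omega) (by omega)

theorem cyc (h : NiceRel R a M) (hk : 4 ≤ k)
    (F : ZMod k → Finset (Fin n)) (hF : ∀ j, (F j).card ≤ M) :
    ∃ p : ZMod k → Fin n, (∀ j, R j (p j) (p (j + 1))) ∧ ∀ j, p j ∉ F j := by
  classical
  have h0 : 0 < (F 0)ᶜ.card := by
    rw [Finset.card_compl, Fintype.card_fin]
    have := hF 0
    have := h.size
    have := h.apos
    omega
  obtain ⟨v, hv⟩ := Finset.card_pos.1 h0
  obtain ⟨S, hS, hSb⟩ := h.degp 0 v (F (0 + 1)) (hF _)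
  obtain ⟨T, hT, hTb⟩ := h.degm (0 - 1) v (F (0 - 1)) (hF _)
  have ha := h.apos
  obtain ⟨x, hx⟩ := Finset.card_pos.1 (show 0 < S.card by omega)
  obtain ⟨y, hy⟩ := Finset.card_pos.1 (show 0 < T.card by omega)
  obtain ⟨p, p1, p2, p3, p4, p5⟩ := h.path' hk 0 v x y (hSb x hx).2 (hTb y hy).2 F hF
  refine ⟨p, p4, fun j => ?_⟩
  by_cases j0 : j = 0
  · subst j0; rw [p1]; simpa using hv
  by_cases j1 : j = 0 + 1
  · subst j1; rw [p2]; exact (hSb x hx).1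
  by_cases j2 : j = 0 - 1
  · subst j2; rw [p3]; exact (hTb y hy).1
  exact p5 j j0 j1 j2

theorem rows (h : NiceRel R a M) (hk : 4 ≤ k) (c x y : ZMod k → Fin n)
    (F : ZMod k → Finset (Fin n)) (hF : ∀ j, (F j).card + k ≤ M)
    (hx : ∀ i, R i (c i) (x i)) (hy : ∀ i, R (i - 1) (y i) (c i))
    (cF : ∀ j, c j ∈ F j) (xF : ∀ j, x j ∈ F (j + 1)) (yF : ∀ j, y j ∈ F (j - 1))
    (hcx : ∀ j, c (j + 1) ≠ x j) (hcy : ∀ j, c (j - 1) ≠ y j)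
    (hxy : ∀ j, x (j - 1) ≠ y (j + 1)) (I : Finset (ZMod k)) :
    ∃ q : ZMod k → ZMod k → Fin n,
      (∀ i ∈ I, q i i = c i ∧ q i (i + 1) = x i ∧ q i (i - 1) = y i ∧
        (∀ j, R j (q i j) (q i (j + 1))) ∧
        ∀ j, j ≠ i → j ≠ i + 1 → j ≠ i - 1 → q i j ∉ F j) ∧
      ∀ i ∈ I, ∀ i' ∈ I, i ≠ i' → ∀ j, q i j ≠ q i' j := by
  classical
  have : NeZero k := ⟨by omega⟩
  induction I using Finset.induction_on with
  | empty => exact ⟨fun i _ => c i, by simp, by simp⟩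
  | insert i₀ I hi₀ ih =>
    obtain ⟨q, hq, hd⟩ := ih
    obtain ⟨p, p1, p2, p3, p4, p5⟩ := h.path' hk i₀ (c i₀) (x i₀) (y i₀) (hx i₀) (hy i₀)
      (fun j => F j ∪ I.image fun i => q i j) (by
        intro j
        have h1 := Finset.card_union_le (F j) (I.image fun i => q i j)
        have h2 := Finset.card_image_le (s := I) (f := fun i => q i j)
        have h3 := Finset.card_le_univ I
        rw [ZMod.card] at h3
        have := hF j
        omega)
    have key : ∀ i ∈ I, ∀ j, p j ≠ q i j := by
      intro i hi j
      have hne : i ≠ i₀ := by rintro rfl; exact hi₀ hi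
      obtain ⟨q1, q2, q3, q4, q5⟩ := hq i hi
      by_cases j0 : j = i₀
      · subst j0
        rw [p1]
        by_cases e1 : j = i + 1
        · subst e1; rw [q2]; exact hcx i
        by_cases e2 : j = i - 1
        · subst e2; rw [q3]; exact hcy i
        intro he
        exact q5 j hne.symm e1 e2 (he ▸ cF j)
      by_cases j1 : j = i₀ + 1
      · subst j1
        rw [p2]
        by_cases e0 : i₀ + 1 = i
        · subst e0; rw [q1]; exact (hcx i₀).symm
        by_cases e1 : i₀ + 1 = i + 1
        · exact absurd (add_right_cancel e1).symm hne
        by_cases e2 : i₀ + 1 = i - 1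
        · rw [e2, q3]
          have := hxy (i - 1)
          rwa [sub_add_cancel, ← e2, add_sub_cancel_right] at this
        intro he
        exact q5 _ e0 e1 e2 (he ▸ xF i₀)
      by_cases j2 : j = i₀ - 1
      · subst j2
        rw [p3]
        by_cases e0 : i₀ - 1 = i
        · subst e0; rw [q1]; exact (hcy i₀).symm
        by_cases e1 : i₀ - 1 = i + 1
        · rw [e1, q2]
          have := hxy (i + 1)
          rw [add_sub_cancel_right, ← e1, sub_add_cancel] at this
          exact this.symm
        by_cases e2 : i₀ - 1 = i - 1
        · exact absurd (sub_left_injective e2).symm hne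
        intro he
        exact q5 _ e0 e1 e2 (he ▸ yF i₀)
      intro he
      apply p5 j j0 j1 j2
      rw [he]
      exact Finset.mem_union_right _ (Finset.mem_image_of_mem (fun i => q i j) hi)
    have hI : ∀ i ∈ I, i ≠ i₀ := by rintro i hi rfl; exact hi₀ hi
    refine ⟨Function.update q i₀ p, ?_, ?_⟩
    · intro i hi
      rcases Finset.mem_insert.1 hi with rfl | hi
      · rw [Function.update_self]
        exact ⟨p1, p2, p3, p4, fun j a b c hh => p5 j a b c (Finset.mem_union_left _ hh)⟩
      · rw [Function.update_of_ne (hI i hi)]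
        exact hq i hi
    · intro i hi i' hi' hne j
      rcases Finset.mem_insert.1 hi with rfl | hiI
      · rcases Finset.mem_insert.1 hi' with rfl | hiI'
        · exact absurd rfl hne
        · rw [Function.update_self, Function.update_of_ne (hI i' hiI')]
          exact key i' hiI' j
      · rcases Finset.mem_insert.1 hi' with rfl | hiI'
        · rw [Function.update_self, Function.update_of_ne (hI i hiI)]
          exact (key i hiI j).symm
        · rw [Function.update_of_ne (hI i hiI), Function.update_of_ne (hI i' hiI')]
          exact hd i hiI i' hiI' hne j

theorem absorber (h : NiceRel R a M) (hk : 4 ≤ k) (s : ZMod k → Fin n)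
    (W : ZMod k → Finset (Fin n)) (B : ℕ) (hW : ∀ j, (W j).card ≤ B)
    (hM : B + 4 * a + k + 5 ≤ M) :
    ∃ q : ZMod k → ZMod k → Fin n,
      (∀ i j, R j (q i j) (q i (j + 1))) ∧ (∀ j, R j (q j j) (q (j + 1) (j + 1))) ∧
      (∀ i, R i (s i) (q i (i + 1))) ∧ (∀ i, R (i - 1) (q i (i - 1)) (s i)) ∧
      (∀ i i' j, q i j = q i' j → i = i') ∧ (∀ i j, q i j ≠ s j) ∧ ∀ i j, q i j ∉ W j := by
  classical
  have : NeZero k := ⟨by omega⟩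
  have hX : ∀ i, ∃ S : Finset (Fin n), S.card = a ∧
      ∀ b ∈ S, b ∉ insert (s (i + 1)) (W (i + 1)) ∧ R i (s i) b := fun i =>
    h.degp i (s i) _ (by
      have := Finset.card_insert_le (s (i + 1)) (W (i + 1))
      have := hW (i + 1)
      omega)
  choose X hXc hX using hX
  have hY : ∀ i, ∃ S : Finset (Fin n), S.card = a ∧
      ∀ b ∈ S, b ∉ insert (s (i - 1)) (W (i - 1)) ∪ X (i - 2) ∧ R (i - 1) b (s i) := fun i =>
    h.degm (i - 1) (s i) _ (by
      have := Finset.card_insert_le (s (i - 1)) (W (i - 1))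
      have := Finset.card_union_le (insert (s (i - 1)) (W (i - 1))) (X (i - 2))
      have := hW (i - 1)
      have := hXc (i - 2)
      omega)
  choose Y hYc hY using hY
  obtain ⟨c, hc, hcF⟩ := h.cyc hk (fun j => insert (s j) (W j) ∪ (X (j - 1) ∪ (Y (j + 1) ∪
      ((Finset.univ.filter fun b => ∀ d ∈ X j, ¬ R j b d) ∪
      (Finset.univ.filter fun b => ∀ d ∈ Y j, ¬ R (j - 1) d b))))) (by
    intro j
    have h1 := h.badm j (X j) (hXc j).ge
    have h2 := h.badp (j - 1) (Y j) (hYc j).ge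
    have := Finset.card_insert_le (s j) (W j)
    have := hW j
    have := hXc (j - 1)
    have := hYc (j + 1)
    refine (Finset.card_union_le _ _).trans ?_
    refine (Nat.add_le_add_left ((Finset.card_union_le _ _).trans (Nat.add_le_add_left
      ((Finset.card_union_le _ _).trans (Nat.add_le_add_left
        (Finset.card_union_le _ _) _)) _)) _).trans ?_
    omega)
  simp only [Finset.mem_union, Finset.mem_insert, Finset.mem_filter, Finset.mem_univ, true_and,
    not_or, not_forall, not_not] at hcF hY hX
  have hxx : ∀ i, ∃ x ∈ X i, R i (c i) x := fun i => by
    obtain ⟨_, _, _, ⟨x, h1, h2⟩, _⟩ := hcF i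
    exact ⟨x, h1, h2⟩
  have hyy : ∀ i, ∃ x ∈ Y i, R (i - 1) x (c i) := fun i => by
    obtain ⟨_, _, _, _, ⟨x, h1, h2⟩⟩ := hcF i
    exact ⟨x, h1, h2⟩
  choose x hx1 hx2 using hxx
  choose y hy1 hy2 using hyy
  have hxs : ∀ j, x j ≠ s (j + 1) ∧ x j ∉ W (j + 1) := fun j => (hX j _ (hx1 j)).1
  have hys : ∀ j, y j ≠ s (j - 1) ∧ y j ∉ W (j - 1) := fun j => (hY j _ (hy1 j)).1.1
  have hcs : ∀ j, c j ≠ s j ∧ c j ∉ W j := fun j => (hcF j).1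
  obtain ⟨q, hq, hd⟩ := h.rows hk c x y
    (fun j => insert (s j) (insert (c j) (insert (x (j - 1)) (insert (y (j + 1)) (W j)))))
    (by
      intro j
      have h1 := Finset.card_insert_le (y (j + 1)) (W j)
      have h2 := Finset.card_insert_le (x (j - 1)) (insert (y (j + 1)) (W j))
      have h3 := Finset.card_insert_le (c j) (insert (x (j - 1)) (insert (y (j + 1)) (W j)))
      have h4 := Finset.card_insert_le (s j)
        (insert (c j) (insert (x (j - 1)) (insert (y (j + 1)) (W j))))
      have := hW j
      omega) hx2 hy2 (by simp) (by simp) (by simp)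
    (by
      intro j he
      have := (hcF (j + 1)).2.1
      rw [add_sub_cancel_right, he] at this
      exact this (hx1 j))
    (by
      intro j he
      have := (hcF (j - 1)).2.2.1
      rw [sub_add_cancel, he] at this
      exact this (hy1 j))
    (by
      intro j he
      have := (hY (j + 1) _ (hy1 (j + 1))).1.2
      rw [show j + 1 - 2 = j - 1 by ring, ← he] at this
      exact this (hx1 (j - 1))) Finset.univ
  have hav : ∀ i j, q i j ≠ s j ∧ q i j ∉ W j := by
    intro i j
    obtain ⟨q1, q2, q3, q4, q5⟩ := hq i (Finset.mem_univ _)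
    by_cases j0 : j = i
    · subst j0; rw [q1]; exact hcs j
    by_cases j1 : j = i + 1
    · subst j1; rw [q2]; exact hxs i
    by_cases j2 : j = i - 1
    · subst j2; rw [q3]; exact hys i
    have := q5 j j0 j1 j2
    simp only [Finset.mem_insert, not_or] at this
    exact ⟨this.1, this.2.2.2.2⟩
  refine ⟨q, fun i j => (hq i (Finset.mem_univ _)).2.2.2.1 j, fun j => ?_, fun i => ?_, fun i => ?_,
    fun i i' j he => ?_, fun i j => (hav i j).1, fun i j => (hav i j).2⟩
  · rw [(hq j (Finset.mem_univ _)).1, (hq (j + 1) (Finset.mem_univ _)).1]; exact hc j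
  · rw [(hq i (Finset.mem_univ _)).2.1]; exact (hX i _ (hx1 i)).2
  · rw [(hq i (Finset.mem_univ _)).2.2.1]; exact (hY i _ (hy1 i)).2
  · by_contra hne
    exact hd i (Finset.mem_univ _) i' (Finset.mem_univ _) hne j he

end NiceRel

theorem hasFactor_of_fintype {k n : ℕ} {ι : Type} [Fintype ι] (G : SimpleGraph (ZMod k × Fin n))
    (A : Set (ZMod k × Fin n)) (c : ι → ZMod k → Fin n)
    (h1 : ∀ j i, G.Adj (i, c j i) (i + 1, c j (i + 1)))
    (h2 : ∀ i j j', c j i = c j' i → j = j')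
    (h3 : ∀ i b, (∃ j, c j i = b) ↔ (i, b) ∈ A) : HasTransversalCkFactorOn G A := by
  refine ⟨Fintype.card ι, fun j => c ((Fintype.equivFin ι).symm j), fun j i => h1 _ i,
    fun i j j' he => ?_, fun i => ?_⟩
  · exact (Fintype.equivFin ι).symm.injective (h2 i _ _ he)
  · ext b
    rw [Set.mem_ofPred_eq, ← h3 i b, Set.mem_range]
    constructor
    · rintro ⟨j, hj⟩; exact ⟨_, hj⟩
    · rintro ⟨j, hj⟩; exact ⟨Fintype.equivFin ι j, by simpa using hj⟩

/-- An absorbing array for `s`. -/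
structure AbsArray {k n : ℕ} (R : ZMod k → Fin n → Fin n → Prop) (s : ZMod k → Fin n)
    (q : ZMod k → ZMod k → Fin n) : Prop where
  row : ∀ i j, R j (q i j) (q i (j + 1))
  diag : ∀ j, R j (q j j) (q (j + 1) (j + 1))
  sp : ∀ i, R i (s i) (q i (i + 1))
  sm : ∀ i, R (i - 1) (q i (i - 1)) (s i)
  inj : ∀ i i' j, q i j = q i' j → i = i'
  ne : ∀ i j, q i j ≠ s j

/-- The vertex set of an array. -/
def arraySet {k n : ℕ} (q : ZMod k → ZMod k → Fin n) : Set (ZMod k × Fin n) :=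
  {v | ∃ i, q i v.1 = v.2}

theorem AbsArray.good {k n : ℕ} (hk : 4 ≤ k) (G : SimpleGraph (ZMod k × Fin n))
    (s : ZMod k → Fin n) (q : ZMod k → ZMod k → Fin n)
    (h : AbsArray (fun i a b => G.Adj (i, a) (i + 1, b)) s q) :
    Disjoint (arraySet q) (Set.range fun i : ZMod k => (i, s i)) ∧
      (arraySet q).ncard ≤ k * (2 * k) ∧
      HasTransversalCkFactorOn G (arraySet q) ∧
      HasTransversalCkFactorOn G (arraySet q ∪ Set.range fun i : ZMod k => (i, s i)) := by
  classical
  have : NeZero k := ⟨by omega⟩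
  have : Fact (1 < k) := ⟨by omega⟩
  refine ⟨?_, ?_, ?_, ?_⟩
  · rw [Set.disjoint_left]
    rintro ⟨j, b⟩ ⟨i, hi⟩ ⟨i', hi'⟩
    simp only [Prod.mk.injEq] at hi hi'
    obtain ⟨rfl, rfl⟩ := hi'
    exact h.ne i i' hi
  · have e : arraySet q ⊆
        ((Finset.univ.image fun ij : ZMod k × ZMod k => (ij.2, q ij.1 ij.2) :
          Finset (ZMod k × Fin n)) : Set (ZMod k × Fin n)) := by
      rintro ⟨j, b⟩ ⟨i, hi⟩
      simp only at hi
      simp only [Finset.coe_image, Finset.coe_univ, Set.image_univ, Set.mem_range, Prod.mk.injEq]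
      exact ⟨(i, j), rfl, hi⟩
    refine (Set.ncard_le_ncard e (Finset.finite_toSet _)).trans ?_
    rw [Set.ncard_coe_finset]
    refine Finset.card_image_le.trans ?_
    simp only [Finset.card_univ, Fintype.card_prod, ZMod.card]
    nlinarith
  · exact hasFactor_of_fintype G _ q (fun i j => h.row i j) (fun j i i' => h.inj i i' j)
      (fun i b => Iff.rfl)
  · refine hasFactor_of_fintype (ι := Option (ZMod k)) G _
      (fun o j => o.elim (q j j) fun i => if j = i then s j else q i j) ?_ ?_ ?_
    · rintro (_ | i) j
      · exact h.diag j
      · simp only [Option.elim_some]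
        by_cases e1 : j = i
        · subst e1
          have : j + 1 ≠ j := by simp
          simp only [this, if_true, if_false]
          exact h.sp j
        · by_cases e2 : j + 1 = i
          · subst e2
            have := h.sm (j + 1)
            simpa [e1] using this
          · simp only [e1, e2, if_false]
            exact h.row i j
    · rintro j (_ | i) (_ | i') he
      · rfl
      · exfalso
        simp only [Option.elim_some, Option.elim_none] at he
        split_ifs at he with e
        · exact h.ne _ _ he
        · exact e (h.inj _ _ _ he)
      · exfalso
        simp only [Option.elim_some, Option.elim_none] at he
        split_ifs at he with e
        · exact h.ne _ _ he.symm
        · exact e (h.inj _ _ _ he.symm)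
      · simp only [Option.elim_some] at he
        split_ifs at he with e e' e'
        · rw [← e, ← e']
        · exact absurd he.symm (h.ne _ _)
        · exact absurd he (h.ne _ _)
        · rw [h.inj _ _ _ he]
    · intro j b
      constructor
      · rintro ⟨_ | i, hi⟩
        · exact Or.inl ⟨j, hi⟩
        · simp only [Option.elim_some] at hi
          split_ifs at hi with e
          · exact Or.inr ⟨j, by simp [hi]⟩
          · exact Or.inl ⟨i, hi⟩
      · rintro (⟨i, hi⟩ | ⟨i, hi⟩)
        · simp only at hi
          by_cases e : j = i
          · subst e; exact ⟨none, hi⟩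
          · exact ⟨some i, by simpa [e] using hi⟩
        · simp only [Prod.mk.injEq] at hi
          obtain ⟨rfl, rfl⟩ := hi
          exact ⟨some i, by simp⟩

theorem NiceRel.greedy {k n : ℕ} {R : ZMod k → Fin n → Fin n → Prop} {a M : ℕ}
    (h : NiceRel R a M) (hk : 4 ≤ k) (s : ZMod k → Fin n) (B : ℕ)
    (hM : B + 4 * a + k + 5 ≤ M) (N : ℕ) (hN : N * k ≤ B) :
    ∃ Q : ℕ → ZMod k → ZMod k → Fin n, (∀ m < N, AbsArray R s (Q m)) ∧
      ∀ m < N, ∀ m' < N, m ≠ m' → ∀ i i' j, Q m i j ≠ Q m' i' j := by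
  classical
  have : NeZero k := ⟨by omega⟩
  induction N with
  | zero => exact ⟨fun _ _ j => s j, by simp, by simp⟩
  | succ N ih =>
    obtain ⟨Q, hQ, hd⟩ := ih (by nlinarith)
    obtain ⟨q, q1, q2, q3, q4, q5, q6, q7⟩ := h.absorber hk s
      (fun j => (Finset.range N ×ˢ (Finset.univ : Finset (ZMod k))).image fun z => Q z.1 z.2 j)
      B (by
        intro j
        refine Finset.card_image_le.trans ?_
        rw [Finset.card_product, Finset.card_range, Finset.card_univ, ZMod.card]
        nlinarith) hM
    have key : ∀ m < N, ∀ i i' j, q i j ≠ Q m i' j := by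
      intro m hm i i' j he
      apply q7 i j
      rw [Finset.mem_image]
      exact ⟨(m, i'), by simpa using hm, he.symm⟩
    refine ⟨fun m => if m < N then Q m else q, ?_, ?_⟩
    · intro m hm
      by_cases hm' : m < N
      · simpa only [hm', if_true] using hQ m hm'
      · simp only [hm', if_false]
        exact ⟨q1, q2, q3, q4, q5, q6⟩
    · intro m hm m' hm' hne i i' j
      by_cases h1 : m < N <;> by_cases h2 : m' < N
      · simpa only [h1, h2, if_true] using hd m h1 m' h2 hne i i' j
      · simpa only [h1, h2, if_true, if_false] using (key m h1 i' i j).symm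
      · simpa only [h1, h2, if_true, if_false] using key m' h2 i i' j
      · omega

theorem exists_sub_avoid {n a M : ℕ} {δ : ℝ} (P : Fin n → Prop)
    (hP : δ * n ≤ (({b : Fin n | P b}).ncard : ℝ)) (hM : ((M + a : ℕ) : ℝ) ≤ δ * n)
    (F : Finset (Fin n)) (hF : F.card ≤ M) :
    ∃ S : Finset (Fin n), S.card = a ∧ ∀ b ∈ S, b ∉ F ∧ P b := by
  classical
  have h1 : ({b : Fin n | P b}).ncard = (Finset.univ.filter P).card := by
    rw [← Set.ncard_coe_finset]; congr 1; ext; simp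
  rw [h1] at hP
  have h2 : M + a ≤ (Finset.univ.filter P).card := by exact_mod_cast hM.trans hP
  have h3 := Finset.le_card_sdiff F (Finset.univ.filter P)
  obtain ⟨S, hS, hSa⟩ := Finset.exists_subset_card_eq
    (show a ≤ (Finset.univ.filter P \ F).card by omega)
  refine ⟨S, hSa, fun b hb => ?_⟩
  have := hS hb
  simp only [Finset.mem_sdiff, Finset.mem_filter, Finset.mem_univ, true_and] at this
  exact ⟨this.2, this.1⟩

theorem exists_common_avoid {n M : ℕ} {δ : ℝ} (P Q : Fin n → Prop)
    (hP : δ * n ≤ (({b : Fin n | P b}).ncard : ℝ))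
    (hQ : δ * n ≤ (({b : Fin n | Q b}).ncard : ℝ)) (hM : (M : ℝ) < (2 * δ - 1) * n)
    (F : Finset (Fin n)) (hF : F.card ≤ M) :
    ∃ b, b ∉ F ∧ P b ∧ Q b := by
  classical
  have h1 : ∀ P : Fin n → Prop, ({b : Fin n | P b}).ncard = (Finset.univ.filter P).card := by
    intro P
    rw [← Set.ncard_coe_finset]; congr 1; ext; simp
  rw [h1] at hP hQ
  have h2 : M + n < (Finset.univ.filter P).card + (Finset.univ.filter Q).card := by
    have : (M : ℝ) + n < (Finset.univ.filter P).card + (Finset.univ.filter Q).card := by linarith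
    exact_mod_cast this
  have h3 := Finset.card_inter_add_card_union (Finset.univ.filter P) (Finset.univ.filter Q)
  have h4 := Finset.card_le_univ (Finset.univ.filter P ∪ Finset.univ.filter Q)
  rw [Fintype.card_fin] at h4
  obtain ⟨b, hb, hbF⟩ := Finset.exists_mem_notMem_of_card_lt_card
    (show F.card < (Finset.univ.filter P ∩ Finset.univ.filter Q).card by omega)
  simp only [Finset.mem_inter, Finset.mem_filter, Finset.mem_univ, true_and] at hb
  exact ⟨b, hbF, hb⟩

/-- **Lemma 5.** Given an integer `k ≥ 4` and `δ > 2/k`, there exist `α, β > 0` such that for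
all sufficiently large `n`: if `G` is a spanning subgraph of the `n`-blow-up of `C_k` with
`δ̄(G) ≥ δn` and `α*_b(G) < αn`, then every transversal `k`-set `S = {(i, s i) : i}` has at
least `(βn − k)/(4k²)` pairwise vertex-disjoint `(C_k, 2k)`-absorbers, i.e., sets
`A ⊆ V(G) \ S` with `|A| ≤ k·(2k)` such that both `G[A]` and `G[A ∪ S]` have transversal
`C_k`-factors. -/
theorem many_disjoint_absorbers
    (k : ℕ) (hk : 4 ≤ k) (δ : ℝ) (hδ : 2 / k < δ) :
    ∃ α β : ℝ, 0 < α ∧ 0 < β ∧ ∃ n₀ : ℕ, ∀ n : ℕ, n₀ ≤ n →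
      ∀ G : SimpleGraph (ZMod k × Fin n),
        (∀ u v : ZMod k × Fin n, G.Adj u v → v.1 = u.1 + 1 ∨ u.1 = v.1 + 1) →
        (∀ (i : ZMod k) (a : Fin n),
          δ * n ≤ (({b : Fin n | G.Adj (i, a) (i + 1, b)}).ncard : ℝ) ∧
          δ * n ≤ (({b : Fin n | G.Adj (i, a) (i - 1, b)}).ncard : ℝ)) →
        (∀ (i : ZMod k) (S T : Finset (Fin n)), S.card = T.card →
          α * n ≤ (S.card : ℝ) → ∃ a ∈ S, ∃ b ∈ T, G.Adj (i, a) (i + 1, b)) →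
        ∀ s : ZMod k → Fin n,
          ∃ (N : ℕ) (A : Fin N → Set (ZMod k × Fin n)),
            (β * n - k) / (4 * (k : ℝ) ^ 2) ≤ (N : ℝ) ∧
            (∀ j₁ j₂ : Fin N, j₁ ≠ j₂ → Disjoint (A j₁) (A j₂)) ∧
            ∀ j : Fin N,
              Disjoint (A j) (Set.range fun i : ZMod k => (i, s i)) ∧
              (A j).ncard ≤ k * (2 * k) ∧
              HasTransversalCkFactorOn G (A j) ∧
              HasTransversalCkFactorOn G
                (A j ∪ Set.range fun i : ZMod k => (i, s i)) := by

  obtain ⟨ε, e0, e1, eδ, e4⟩ : ∃ ε : ℝ, 0 < ε ∧ ε ≤ 1 ∧ ε ≤ δ ∧ (k = 4 → ε ≤ 2 * δ - 1) := by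
    have hδ0 : 0 < δ := lt_of_le_of_lt (by positivity) hδ
    by_cases h4 : k = 4
    · subst h4
      norm_num at hδ
      refine ⟨min 1 (min δ (2 * δ - 1)), ?_, min_le_left _ _, ?_, fun _ => ?_⟩
      · refine lt_min one_pos (lt_min hδ0 ?_)
        linarith
      · exact (min_le_right _ _).trans (min_le_left _ _)
      · exact (min_le_right _ _).trans (min_le_right _ _)
    · exact ⟨min 1 δ, lt_min one_pos hδ0, min_le_left _ _, min_le_right _ _,
        fun h => absurd h h4⟩
  refine ⟨ε / 20, ε / 20, by positivity, by positivity, ⌈2 * ((k : ℝ) + 12) / (ε / 20)⌉₊, ?_⟩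
  intro n hn G _ hdeg hhole s
  have hkR : (4 : ℝ) ≤ k := by exact_mod_cast hk
  have hnR : 2 * ((k : ℝ) + 12) ≤ ε / 20 * n := by
    have := (Nat.le_ceil _).trans (Nat.cast_le (α := ℝ).2 hn)
    rwa [div_le_iff₀' (by positivity)] at this
  set a := ⌈ε / 20 * n⌉₊ with ha
  have a1 : ε / 20 * n ≤ a := Nat.le_ceil _
  have a2 : (a : ℝ) < ε / 20 * n + 1 := Nat.ceil_lt_add_one (by positivity)
  have hn0 : (0 : ℝ) ≤ n := Nat.cast_nonneg n
  have hεn : ε * n ≤ n := by nlinarith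
  have hεδ : ε * n ≤ δ * n := by nlinarith
  have hMa : ((a + 4 * a + k + 5 + a : ℕ) : ℝ) ≤ δ * n := by push_cast; linarith
  have hback : ∀ (i : ZMod k) (y : Fin n),
      δ * n ≤ (({b : Fin n | G.Adj (i, b) (i + 1, y)}).ncard : ℝ) := by
    intro i y
    have := (hdeg (i + 1) y).2
    rw [add_sub_cancel_right] at this
    simpa only [G.adj_comm] using this
  have nice : NiceRel (fun i x y => G.Adj (i, x) (i + 1, y)) a (a + 4 * a + k + 5) := by
    refine ⟨?_, ?_, ?_, ?_, ?_, ?_⟩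
    · intro i S T hS hT
      obtain ⟨S', hS', hS'c⟩ := Finset.exists_subset_card_eq hS
      obtain ⟨T', hT', hT'c⟩ := Finset.exists_subset_card_eq hT
      obtain ⟨x, hx, y, hy, hxy⟩ := hhole i S' T' (hS'c.trans hT'c.symm) (by rw [hS'c]; exact a1)
      exact ⟨x, hS' hx, y, hT' hy, hxy⟩
    · intro i x F hF
      exact exists_sub_avoid _ (hdeg i x).1 hMa F hF
    · intro i y F hF
      exact exists_sub_avoid _ (hback i y) hMa F hF
    · have : ((a + 4 * a + k + 5 + 2 * a : ℕ) : ℝ) ≤ n := by push_cast; linarith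
      exact_mod_cast this
    · have : (1 : ℝ) ≤ a := by linarith
      exact_mod_cast this
    · intro h4 i x y F hF
      refine exists_common_avoid _ _ (hdeg i x).1 (hback (i + 1) y) ?_ F hF
      have := mul_le_mul_of_nonneg_right (e4 h4) hn0
      push_cast
      linarith
  set N := ⌈(ε / 20 * n - k) / (4 * (k : ℝ) ^ 2)⌉₊ with hNdef
  have hN : N * k ≤ a := by
    have h1 : (N : ℝ) < (ε / 20 * n - k) / (4 * (k : ℝ) ^ 2) + 1 :=
      Nat.ceil_lt_add_one (div_nonneg (by linarith) (by positivity))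
    have h2 : (ε / 20 * n - k) / (4 * (k : ℝ) ^ 2) * k = (ε / 20 * n - k) / (4 * k) := by
      field_simp
    have h3 : (ε / 20 * n - k) / (4 * k) ≤ (ε / 20 * n - k) / 2 := by
      apply div_le_div_of_nonneg_left (by linarith) (by norm_num) (by linarith)
    have h4 : (N : ℝ) * k ≤ a := by nlinarith
    exact_mod_cast h4
  obtain ⟨Q, hQ, hd⟩ := nice.greedy hk s a le_rfl N hN
  refine ⟨N, fun j => arraySet (Q j), Nat.le_ceil _, ?_, fun j => (hQ j j.2).good hk G s _⟩
  intro j₁ j₂ hne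
  rw [Set.disjoint_left]
  rintro ⟨t, b⟩ ⟨i, hi⟩ ⟨i', hi'⟩
  exact hd j₁ j₁.2 j₂ j₂.2 (fun h => hne (Fin.ext h)) i i' t (hi.trans hi'.symm)
end

section
/- Given an integer k ≥ 2 and a constant 0 < α ≤ 1/2, let G = (V₁, …, V_k, E) be a spanning subgraph of the n-blow-up of C_k with α*_b(G) < αn. Then for any integers i, j with 1 ≤ i < j ≤ k and any collection of sets X_s ⊆ V_s for s ∈ [i, j] satisfying |X_i| ≥ αn, |X_j| ≥ αn, and |X_ℓ| ≥ 2αn for all ℓ with i < ℓ < j, there exists a path x_i x_{i+1} ⋯ x_{j−1} x_j in G with x_s ∈ X_s for each s ∈ [i, j]. -/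
/-- **Proposition (transversal path).** Let `k ≥ 2`, `0 < α ≤ 1/2`, and let `G` be a spanning
subgraph of the `n`-blow-up of `C_k` with `α*_b(G) < αn`. For any `1 ≤ i < j ≤ k` and sets
`X_s ⊆ V_s` for `s ∈ [i, j]` with `|X_i|, |X_j| ≥ αn` and `|X_ℓ| ≥ 2αn` for `i < ℓ < j`,
there exists a path `x_i x_{i+1} ⋯ x_j` in `G` with `x_s ∈ X_s` for every `s ∈ [i, j]`. -/
theorem transversal_path_between_sets
    (k : ℕ) (hk : 2 ≤ k) (α : ℝ) (hα0 : 0 < α) (hα : α ≤ 1 / 2) (n : ℕ)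
    (G : SimpleGraph (ZMod k × Fin n))
    (hspan : ∀ u v : ZMod k × Fin n, G.Adj u v → v.1 = u.1 + 1 ∨ u.1 = v.1 + 1)
    (hbα : ∀ (i : ZMod k) (S T : Finset (Fin n)), S.card = T.card →
      α * n ≤ (S.card : ℝ) → ∃ a ∈ S, ∃ b ∈ T, G.Adj (i, a) (i + 1, b))
    (i j : ℕ) (hi : 1 ≤ i) (hij : i < j) (hj : j ≤ k)
    (X : ℕ → Set (Fin n))
    (hXi : α * n ≤ ((X i).ncard : ℝ))
    (hXj : α * n ≤ ((X j).ncard : ℝ))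
    (hXmid : ∀ ℓ : ℕ, i < ℓ → ℓ < j → 2 * α * n ≤ ((X ℓ).ncard : ℝ)) :
    ∃ x : ℕ → Fin n,
      (∀ s : ℕ, i ≤ s → s ≤ j → x s ∈ X s) ∧
      (∀ s : ℕ, i ≤ s → s < j →
        G.Adj ((s : ZMod k), x s) (((s + 1 : ℕ) : ZMod k), x (s + 1))) := by
  classical
  -- any two large sets in consecutive parts have an edge between them
  have edge : ∀ (c : ZMod k) (A B : Finset (Fin n)), α * n ≤ (A.card : ℝ) →
      α * n ≤ (B.card : ℝ) → ∃ a ∈ A, ∃ b ∈ B, G.Adj (c, a) (c + 1, b) := by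
    intro c A B hA hB
    obtain ⟨S, hSA, hS⟩ := Finset.exists_subset_card_eq (Nat.ceil_le.mpr hA)
    obtain ⟨T, hTB, hT⟩ := Finset.exists_subset_card_eq (Nat.ceil_le.mpr hB)
    obtain ⟨a, ha, b, hb, hab⟩ := hbα c S T (hS.trans hT.symm)
      (by rw [hS]; exact Nat.le_ceil _)
    exact ⟨a, hSA ha, b, hTB hb, hab⟩
  -- extending a transversal path by one vertex
  have extend : ∀ (s : ℕ) (x : ℕ → Fin n) (b : Fin n), i ≤ s →
      (∀ t, i ≤ t → t ≤ s → x t ∈ X t) →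
      (∀ t, i ≤ t → t < s →
        G.Adj ((t : ZMod k), x t) (((t + 1 : ℕ) : ZMod k), x (t + 1))) →
      b ∈ X (s + 1) → G.Adj ((s : ZMod k), x s) ((s : ZMod k) + 1, b) →
      ∃ y : ℕ → Fin n, y (s + 1) = b ∧ (∀ t, i ≤ t → t ≤ s + 1 → y t ∈ X t) ∧
      (∀ t, i ≤ t → t < s + 1 →
        G.Adj ((t : ZMod k), y t) (((t + 1 : ℕ) : ZMod k), y (t + 1))) := by
    intro s x b his h1 h2 hb hadj
    refine ⟨Function.update x (s + 1) b, by simp, ?_, ?_⟩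
    · intro t hit hts
      rcases Nat.eq_or_lt_of_le hts with h | h
      · subst h; simpa using hb
      · rw [Function.update_of_ne (by omega)]
        exact h1 t hit (by omega)
    · intro t hit hts
      rw [Function.update_of_ne (by omega : t ≠ s + 1)]
      rcases Nat.eq_or_lt_of_le (Nat.le_of_lt_succ hts) with h | h
      · subst h
        simpa using hadj
      · rw [Function.update_of_ne (by omega)]
        exact h2 t hit h
  -- many vertices are reachable at each level before the last one
  have reach : ∀ s : ℕ, i ≤ s → s < j → ∃ R : Finset (Fin n), α * n ≤ (R.card : ℝ) ∧
      ∀ v ∈ R, ∃ x : ℕ → Fin n, x s = v ∧ (∀ t, i ≤ t → t ≤ s → x t ∈ X t) ∧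
      (∀ t, i ≤ t → t < s →
        G.Adj ((t : ZMod k), x t) (((t + 1 : ℕ) : ZMod k), x (t + 1))) := by
    intro s his
    induction s, his using Nat.le_induction with
    | base =>
      intro _
      refine ⟨(X i).toFinset, by rwa [← Set.ncard_eq_toFinset_card'], ?_⟩
      intro v hv
      refine ⟨fun _ => v, rfl, ?_, ?_⟩
      · intro t h1 h2
        obtain rfl : t = i := by omega
        simpa using hv
      · intro t h1 h2
        omega
    | succ s his ih =>
      intro hsj
      obtain ⟨R, hR, hpath⟩ := ih (by omega)
      have hX := hXmid (s + 1) (by omega) hsj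
      rw [Set.ncard_eq_toFinset_card'] at hX
      let p : Fin n → Prop := fun b => ∃ a ∈ R, G.Adj ((s : ZMod k), a) ((s : ZMod k) + 1, b)
      have hsplit := Finset.card_filter_add_card_filter_not (s := (X (s + 1)).toFinset) p
      refine ⟨(X (s + 1)).toFinset.filter p, ?_, ?_⟩
      · by_contra hlt
        push Not at hlt
        have hbig : α * n ≤ (((X (s + 1)).toFinset.filter (fun b => ¬ p b)).card : ℝ) := by
          have : ((((X (s + 1)).toFinset.filter p).card : ℝ)) +
              (((X (s + 1)).toFinset.filter (fun b => ¬ p b)).card : ℝ) =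
              ((X (s + 1)).toFinset.card : ℝ) := by exact_mod_cast hsplit
          linarith
        obtain ⟨a, ha, b, hb, hab⟩ := edge (s : ZMod k) R _ hR hbig
        exact (Finset.mem_filter.mp hb).2 ⟨a, ha, hab⟩
      · intro v hv
        obtain ⟨hvX, a, ha, hav⟩ := Finset.mem_filter.mp hv
        obtain ⟨x, rfl, h1, h2⟩ := hpath a ha
        exact extend s x v his h1 h2 (by simpa using hvX) hav
  obtain ⟨s, rfl⟩ : ∃ s, j = s + 1 := ⟨j - 1, by omega⟩
  obtain ⟨R, hR, hpath⟩ := reach s (by omega) (by omega)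
  rw [Set.ncard_eq_toFinset_card'] at hXj
  obtain ⟨a, ha, b, hb, hab⟩ := edge (s : ZMod k) R _ hR hXj
  obtain ⟨x, rfl, h1, h2⟩ := hpath a ha
  obtain ⟨y, -, h3, h4⟩ := extend s x b (by omega) h1 h2 (by simpa using hb) hab
  exact ⟨y, h3, h4⟩
end

section
/- Let H be a bipartite graph with parts A and B, each of size N, such that every vertex of A has at least d neighbors in B and every vertex of B has at least d neighbors in A. Then H contains a matching of size at least min{N, 2d}. -/
/-- **Bipartite matching via König's theorem.** Let `H` be a bipartite graph with parts `A`
and `B`, each of size `N` (encoded by the adjacency relation `r : A → B → Prop`), such that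
every vertex of `A` has at least `d` neighbors in `B` and every vertex of `B` has at least
`d` neighbors in `A`. Then `H` contains a matching of size at least `min N (2d)`. -/
theorem bipartite_min_degree_matching
    (A B : Type*) [Fintype A] [Fintype B] (N d : ℕ)
    (hA : Fintype.card A = N) (hB : Fintype.card B = N)
    (r : A → B → Prop)
    (hdA : ∀ a : A, d ≤ ({b : B | r a b}).ncard)
    (hdB : ∀ b : B, d ≤ ({a : A | r a b}).ncard) :
    ∃ (s : Finset A) (g : A → B),
      min N (2 * d) ≤ s.card ∧ Set.InjOn g ↑s ∧ ∀ a ∈ s, r a (g a) := by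
  classical
  obtain ⟨e⟩ : Nonempty (A ≃ B) := Fintype.card_eq.mp (hA.trans hB.symm)
  have hA' : ∀ a : A, d ≤ (Finset.univ.filter (fun b => r a b)).card := by
    intro a
    have := hdA a
    rwa [Set.ncard_eq_toFinset_card', Set.toFinset_setOf] at this
  have hB' : ∀ b : B, d ≤ (Finset.univ.filter (fun a => r a b)).card := by
    intro b
    have := hdB b
    rwa [Set.ncard_eq_toFinset_card', Set.toFinset_setOf] at this
  -- add `k` dummy vertices adjacent to everything and apply Hall
  obtain ⟨k, hk⟩ : ∃ k, k = N - min N (2 * d) := ⟨_, rfl⟩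
  let t : A → Finset (B ⊕ Fin k) := fun a =>
    (Finset.univ.filter (fun b => r a b)).disjSum Finset.univ
  have hall : ∀ S : Finset A, S.card ≤ (S.biUnion t).card := by
    intro S
    rcases S.eq_empty_or_nonempty with rfl | ⟨a₀, ha₀⟩
    · simp
    have hEq : S.biUnion t =
        (Finset.univ.filter (fun b => ∃ a ∈ S, r a b)).disjSum Finset.univ := by
      ext x
      rcases x with b | i
      · simp [t]
      · simp only [t, Finset.mem_biUnion, Finset.inr_mem_disjSum, Finset.mem_univ, and_true,
          iff_true]
        exact ⟨a₀, ha₀⟩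
    rw [hEq, Finset.card_disjSum, Finset.card_univ, Fintype.card_fin]
    by_cases hall : ∀ b, ∃ a ∈ S, r a b
    · have h1 : (Finset.univ.filter (fun b => ∃ a ∈ S, r a b)) = Finset.univ := by
        simpa [Finset.filter_eq_self] using hall
      have h2 := S.card_le_univ
      rw [h1, Finset.card_univ]
      omega
    · push Not at hall
      obtain ⟨b, hb⟩ := hall
      have h1 : Disjoint S (Finset.univ.filter (fun a => r a b)) := by
        rw [Finset.disjoint_left]
        intro a ha h
        exact hb a ha (by simpa using h)
      have h2 := (S ∪ Finset.univ.filter (fun a => r a b)).card_le_univ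
      rw [Finset.card_union_of_disjoint h1] at h2
      have h3 := hB' b
      have h4 : (Finset.univ.filter (fun b => r a₀ b)).card ≤
          (Finset.univ.filter (fun b => ∃ a ∈ S, r a b)).card := by
        apply Finset.card_le_card
        intro x hx
        simp only [Finset.mem_filter, Finset.mem_univ, true_and] at hx ⊢
        exact ⟨a₀, ha₀, hx⟩
      have h5 := hA' a₀
      omega
  obtain ⟨f, hf, hft⟩ := (Finset.all_card_le_biUnion_card_iff_exists_injective t).mp hall
  let g : A → B := fun a => Sum.elim id (fun _ => e a) (f a)
  have hg : ∀ a, (f a).isLeft = true → f a = Sum.inl (g a) := by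
    intro a ha
    rcases h : f a with b | i
    · simp [g, h]
    · simp [h] at ha
  refine ⟨Finset.univ.filter (fun a => (f a).isLeft = true), g, ?_, ?_, ?_⟩
  · have h1 := Finset.card_filter_add_card_filter_not (s := (Finset.univ : Finset A))
      (fun a => (f a).isLeft = true)
    have h2 : (Finset.univ.filter (fun a => ¬ (f a).isLeft = true)).card ≤ k := by
      have h3 : ((Finset.univ.filter (fun a => ¬ (f a).isLeft = true)).image f) ⊆
          (Finset.univ : Finset (Fin k)).image Sum.inr := by
        intro x hx
        simp only [Finset.mem_image, Finset.mem_filter, Finset.mem_univ, true_and] at hx ⊢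
        obtain ⟨a, ha, rfl⟩ := hx
        rcases h : f a with b | i
        · simp [h] at ha
        · exact ⟨i, rfl⟩
      have h4 := Finset.card_le_card h3
      rw [Finset.card_image_of_injective _ hf] at h4
      refine h4.trans (Finset.card_image_le.trans ?_)
      simp
    rw [Finset.card_univ] at h1
    omega
  · intro a ha b hb hab
    apply hf
    rw [hg a (by simpa using ha), hg b (by simpa using hb), hab]
  · intro a ha
    have h := hft a
    rw [hg a (by simpa using ha)] at h
    simpa [t] using h
end

section
/- Given an integer k ≥ 4 and a constant δ > 2/k, there exist α, β > 0 such that the following holds for all sufficiently large n: if G = (V₁, …, V_k, E) is a spanning subgraph of the n-blow-up of C_k with δ̄(G) ≥ δn and α*_b(G) < αn, then for each i ∈ [k] the part V_i is (C_k, βn, 2)-closed, i.e., any two vertices u, v ∈ V_i are (C_k, βn, 2)-reachable in G. -/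
open Finset in
open Classical in
/-- The path lemma: reachable end sets stay large. -/
lemma path_aux {k n h : ℕ} (G : SimpleGraph (ZMod k × Fin n))
    (hole : ∀ (i : ZMod k) (S T : Finset (Fin n)), h ≤ S.card → h ≤ T.card →
      ∃ a ∈ S, ∃ b ∈ T, G.Adj (i, a) (i + 1, b))
    (s : ZMod k) (y : Fin n) (Y : ZMod k → Finset (Fin n))
    (hY : ∀ j : ℕ, j + 2 ≤ k → 2 * h ≤ (Y (s + ((j + 1 : ℕ) : ZMod k))).card)
    (hy : ∀ b ∈ Y (s + 1), G.Adj (s, y) (s + 1, b)) (j : ℕ) (hj : j + 2 ≤ k) :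
    h ≤ ((Y (s + ((j + 1 : ℕ) : ZMod k))).filter (fun b => ∃ p : ℕ → Fin n, p 0 = y ∧
      p (j + 1) = b ∧ ∀ t ≤ j, p (t + 1) ∈ Y (s + ((t + 1 : ℕ) : ZMod k)) ∧
        G.Adj (s + (t : ZMod k), p t) (s + (t : ZMod k) + 1, p (t + 1)))).card := by
  induction j with
  | zero =>
    rw [Finset.filter_true_of_mem]
    · have := hY 0 hj
      omega
    · intro b hb
      refine ⟨fun t => if t = 0 then y else b, by simp, by simp, ?_⟩
      intro t ht
      obtain rfl : t = 0 := by omega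
      refine ⟨by simpa using hb, ?_⟩
      have := hy b (by simpa using hb)
      simpa using this
  | succ j ih =>
    have ih := ih (by omega)
    have hbig := hY (j + 1) hj
    by_contra hcon
    set P : Fin n → Prop := (fun b => ∃ p : ℕ → Fin n, p 0 = y ∧
      p (j + 1 + 1) = b ∧ ∀ t ≤ j + 1, p (t + 1) ∈ Y (s + ((t + 1 : ℕ) : ZMod k)) ∧
        G.Adj (s + (t : ZMod k), p t) (s + (t : ZMod k) + 1, p (t + 1))) with hP
    have hsplit := Finset.card_filter_add_card_filter_not
      (s := Y (s + ((j + 1 + 1 : ℕ) : ZMod k))) P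
    have hcon' : ¬ h ≤ ((Y (s + ((j + 1 + 1 : ℕ) : ZMod k))).filter P).card := by
      convert hcon
    obtain ⟨a, ha, b, hb, hab⟩ := hole (s + ((j + 1 : ℕ) : ZMod k)) _
      ((Y (s + ((j + 1 + 1 : ℕ) : ZMod k))).filter (fun b => ¬ P b)) ih (by omega)
    rw [Finset.mem_filter] at ha hb
    obtain ⟨ha1, p, hp0, hpj, hp⟩ := ha
    apply hb.2
    refine ⟨fun t => if t = j + 2 then b else p t, by simp [hp0], by simp, ?_⟩
    intro t ht
    rcases Nat.lt_or_ge t (j + 1) with h1 | h1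
    · have := hp t (by omega)
      have e1 : ¬ (t + 1 = j + 2) := by omega
      have e2 : ¬ (t = j + 2) := by omega
      simpa only [e1, e2, if_false] using this
    · obtain rfl : t = j + 1 := by omega
      refine ⟨by simpa using hb.1, ?_⟩
      have e2 : ¬ (j + 1 = j + 2) := by omega
      simpa [e2, hpj] using hab

/-- Closing the path up to a cycle. -/
lemma cycle_aux {k n h : ℕ} (hk : 4 ≤ k) (hh : 1 ≤ h) (G : SimpleGraph (ZMod k × Fin n))
    (hole : ∀ (i : ZMod k) (S T : Finset (Fin n)), h ≤ S.card → h ≤ T.card →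
      ∃ a ∈ S, ∃ b ∈ T, G.Adj (i, a) (i + 1, b))
    (s : ZMod k) (y : Fin n) (Y : ZMod k → Finset (Fin n))
    (hY : ∀ x : ZMod k, x ≠ s → 2 * h ≤ (Y x).card)
    (hy : ∀ b ∈ Y (s + 1), G.Adj (s, y) (s + 1, b))
    (hy' : ∀ b ∈ Y (s - 1), G.Adj (s - 1, b) (s, y)) :
    ∃ c : ZMod k → Fin n, (∀ x, G.Adj (x, c x) (x + 1, c (x + 1))) ∧ c s = y ∧
      ∀ x, x ≠ s → c x ∈ Y x := by
  classical
  have : NeZero k := ⟨by omega⟩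
  have hY' : ∀ j : ℕ, j + 2 ≤ k → 2 * h ≤ (Y (s + ((j + 1 : ℕ) : ZMod k))).card := by
    intro j hj
    apply hY
    intro he
    have h0 : ((j + 1 : ℕ) : ZMod k) = 0 := by simpa using he
    rw [ZMod.natCast_eq_zero_iff] at h0
    have := Nat.le_of_dvd (by omega) h0
    omega
  have hp := path_aux G hole s y Y hY' hy (k - 2) (by omega)
  obtain ⟨b, hb⟩ := Finset.card_pos.mp (lt_of_lt_of_le (by omega : 0 < h) hp)
  rw [Finset.mem_filter] at hb
  obtain ⟨-, p, hp0, -, hp⟩ := hb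
  refine ⟨fun x => p (x - s).val, ?_, by simp [hp0], ?_⟩
  · intro x
    have hx : s + (((x - s).val : ℕ) : ZMod k) = x := by simp
    have hlt := ZMod.val_lt (x - s)
    change G.Adj (x, p (x - s).val) (x + 1, p (x + 1 - s).val)
    generalize (x - s).val = t at *
    subst hx
    have e : (s + (t : ZMod k) + 1 - s) = ((t + 1 : ℕ) : ZMod k) := by push_cast; ring
    rw [e]
    rcases Nat.lt_or_ge (t + 1) k with h1 | h1
    · rw [ZMod.val_natCast, Nat.mod_eq_of_lt h1]
      exact (hp t (by omega)).2
    · obtain rfl : k = t + 1 := by omega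
      have e0 : ((t + 1 : ℕ) : ZMod (t + 1)) = 0 := ZMod.natCast_self _
      have e1 : s + (t : ZMod (t + 1)) = s - 1 := by
        push_cast at e0
        linear_combination e0
      rw [e0, ZMod.val_zero, hp0, e1, sub_add_cancel]
      have := (hp (t - 1) (by omega)).1
      rw [show t - 1 + 1 = t by omega, e1] at this
      exact hy' _ this
  · intro x hx
    have hx' : s + (((x - s).val : ℕ) : ZMod k) = x := by simp
    have hlt := ZMod.val_lt (x - s)
    have hne : (x - s).val ≠ 0 := by
      rw [Ne, ZMod.val_eq_zero, sub_eq_zero]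
      exact hx
    have := (hp ((x - s).val - 1) (by omega)).1
    rw [show (x - s).val - 1 + 1 = (x - s).val by omega, hx'] at this
    exact this

lemma zmod_ne {k m : ℕ} (hm : 0 < m) (hmk : m < k) : ((m : ℕ) : ZMod k) ≠ 0 := by
  intro h
  rw [ZMod.natCast_eq_zero_iff] at h
  have := Nat.le_of_dvd hm h
  omega

lemma card_sdiff_ge {n d f : ℕ} (p : Fin n → Prop) (F : Finset (Fin n)) [DecidablePred p]
    [DecidablePred (fun b => p b ∧ b ∉ F)]
    (hp : d ≤ (Finset.univ.filter p).card) (hF : F.card ≤ f) :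
    d ≤ (Finset.univ.filter (fun b => p b ∧ b ∉ F)).card + f := by
  have : Finset.univ.filter p ⊆ Finset.univ.filter (fun b => p b ∧ b ∉ F) ∪ F := by
    intro b hb
    simp only [Finset.mem_filter, Finset.mem_union, Finset.mem_univ, true_and] at *
    tauto
  have := (Finset.card_le_card this).trans (Finset.card_union_le _ _)
  omega

open Classical in
lemma key_cycle {k n h d f : ℕ} (hk : 4 ≤ k) (hh : 1 ≤ h) (G : SimpleGraph (ZMod k × Fin n))
    (hole : ∀ (i : ZMod k) (S T : Finset (Fin n)), h ≤ S.card → h ≤ T.card →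
      ∃ a ∈ S, ∃ b ∈ T, G.Adj (i, a) (i + 1, b))
    (hdp : ∀ (i : ZMod k) (a : Fin n),
      d ≤ (Finset.univ.filter (fun b => G.Adj (i, a) (i + 1, b))).card)
    (hdm : ∀ (i : ZMod k) (a : Fin n),
      d ≤ (Finset.univ.filter (fun b => G.Adj (i, a) (i - 1, b))).card)
    (hfd : f + 2 * h ≤ d) (hk4 : k = 4 → n + f + 2 * h ≤ 2 * d)
    (havg : n * (2 * h) < (d - f) * (d - f))
    (i : ZMod k) (u : Fin n) (X : Finset (Fin n)) (hX : 2 * h ≤ X.card)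
    (F : ZMod k → Finset (Fin n)) (hF : ∀ j, (F j).card ≤ f) :
    ∃ c : ZMod k → Fin n, (∀ x, G.Adj (x, c x) (x + 1, c (x + 1))) ∧ c i ∈ X ∧
      (∀ x, x ≠ i → c x ∉ F x) ∧ G.Adj (i, u) (i + 1, c (i + 1)) ∧
      G.Adj (i, u) (i - 1, c (i - 1)) := by
  have hdn : d ≤ n := (hdp i u).trans ((Finset.card_le_univ _).trans (by simp))
  have n1 : (1 : ZMod k) ≠ 0 := by simpa using zmod_ne (k := k) (m := 1) (by omega) (by omega)
  have n2 : (2 : ZMod k) ≠ 0 := by simpa using zmod_ne (k := k) (m := 2) (by omega) (by omega)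
  have n3 : (3 : ZMod k) ≠ 0 := by simpa using zmod_ne (k := k) (m := 3) (by omega) (by omega)
  -- the averaging step
  set A := Finset.univ.filter (fun b => G.Adj (i, u) (i + 1, b) ∧ b ∉ F (i + 1)) with hA
  have hAc : d ≤ A.card + f := card_sdiff_ge _ _ (hdp i u) (hF _)
  have hy : ∃ y, y ∉ F (i + 2) ∧
      2 * h ≤ (A.filter (fun b => G.Adj (i + 1, b) (i + 2, y))).card := by
    by_contra hcon
    push Not at hcon
    set C := Finset.univ.filter (fun y => y ∉ F (i + 2)) with hC
    have hdc := Finset.sum_card_bipartiteAbove_eq_sum_card_bipartiteBelow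
      (s := A) (t := C) (fun b y => G.Adj (i + 1, b) (i + 2, y))
    have h1 : A.card * (d - f) ≤
        ∑ b ∈ A, (Finset.bipartiteAbove (fun b y => G.Adj (i + 1, b) (i + 2, y)) C b).card := by
      rw [← smul_eq_mul]
      apply Finset.card_nsmul_le_sum
      intro b hb
      have := card_sdiff_ge _ (F (i + 2)) (hdp (i + 1) b) (hF _)
      rw [show i + 1 + 1 = i + 2 by ring] at this
      have e : Finset.bipartiteAbove (fun b y => G.Adj (i + 1, b) (i + 2, y)) C b =
          Finset.univ.filter (fun y => G.Adj (i + 1, b) (i + 2, y) ∧ y ∉ F (i + 2)) := by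
        ext y
        simp [Finset.bipartiteAbove, hC, and_comm]
      rw [e]
      omega
    have h2 : ∑ y ∈ C, (Finset.bipartiteBelow (fun b y => G.Adj (i + 1, b) (i + 2, y)) A y).card
        ≤ C.card * (2 * h) := by
      rw [← smul_eq_mul]
      apply Finset.sum_le_card_nsmul
      intro y hy
      have := hcon y (by simpa [hC] using hy)
      exact this.le
    have h3 : C.card ≤ n := (Finset.card_le_univ _).trans (by simp)
    have h4 : C.card * (2 * h) ≤ n * (2 * h) := Nat.mul_le_mul_right _ h3
    have h5 : (d - f) * (d - f) ≤ A.card * (d - f) := Nat.mul_le_mul_right _ (by omega)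
    omega
  obtain ⟨y, hyF, hyA⟩ := hy
  set Y : ZMod k → Finset (Fin n) := fun x => Finset.univ.filter (fun b =>
    (x = i → b ∈ X) ∧ (x ≠ i → b ∉ F x) ∧
    (x = i + 1 → G.Adj (i, u) (i + 1, b) ∧ G.Adj (i + 1, b) (i + 2, y)) ∧
    (x = i - 1 → G.Adj (i, u) (i - 1, b)) ∧
    (x = i + 3 → G.Adj (i + 2, y) (i + 3, b))) with hYdef
  have e1 : i + 1 ≠ i := by simpa using n1
  have e2 : i - 1 ≠ i := by simpa using n1
  have e3 : i + 3 ≠ i := by simpa using n3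
  have e4 : i + 1 ≠ i - 1 := by
    intro h; apply n2; linear_combination h
  have e5 : i + 1 ≠ i + 3 := by
    intro h; apply n2; linear_combination -h
  have e6 : i + 2 ≠ i := by simpa using n2
  have e7 : i + 2 ≠ i + 1 := by
    intro h; apply n1; linear_combination h
  have e8 : i + 2 ≠ i - 1 := by
    intro h; apply n3; linear_combination h
  have hN3 : d ≤ (Finset.univ.filter (fun b => G.Adj (i + 2, y) (i + 3, b))).card := by
    have := hdp (i + 2) y
    rwa [show i + 2 + 1 = i + 3 by ring] at this
  have hYc : ∀ x, x ≠ i + 2 → 2 * h ≤ (Y x).card := by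
    intro x hx
    by_cases hxi : x = i
    · subst hxi
      refine hX.trans (Finset.card_le_card ?_)
      intro b hb
      simp [hYdef, hb, e1.symm, e2.symm, e3.symm, n1, n3]
    by_cases hx1 : x = i + 1
    · subst hx1
      refine hyA.trans (Finset.card_le_card ?_)
      intro b hb
      simp only [hA, Finset.mem_filter, Finset.mem_univ, true_and] at hb
      simp only [hYdef, Finset.mem_filter, Finset.mem_univ, true_and]
      exact ⟨fun h => absurd h e1, fun _ => hb.1.2, fun _ => ⟨hb.1.1, hb.2⟩,
        fun h => absurd h e4, fun h => absurd h e5⟩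
    by_cases hx3 : x = i + 3
    · by_cases hxm : x = i - 1
      · have h4 : k = 4 := by
          by_contra hne
          have := zmod_ne (k := k) (m := 4) (by omega) (by omega)
          apply this
          push_cast
          linear_combination hx3.symm.trans hxm
        have hk4 := hk4 h4
        have hB := hdm i u
        have hie := Finset.card_union_add_card_inter
          (Finset.univ.filter (fun b => G.Adj (i, u) (i - 1, b)))
          (Finset.univ.filter (fun b => G.Adj (i + 2, y) (i + 3, b)))
        have hle := Finset.card_le_univ
          ((Finset.univ.filter (fun b => G.Adj (i, u) (i - 1, b))) ∪
          (Finset.univ.filter (fun b => G.Adj (i + 2, y) (i + 3, b))))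
        rw [Fintype.card_fin] at hle
        have hI : ((Finset.univ.filter (fun b => G.Adj (i, u) (i - 1, b))) ∩
          (Finset.univ.filter (fun b => G.Adj (i + 2, y) (i + 3, b)))).card ≤
          (Finset.univ.filter (fun b => G.Adj (i, u) (i - 1, b) ∧
            G.Adj (i + 2, y) (i + 3, b))).card :=
          Finset.card_le_card (by intro b; simp)
        have h6 := card_sdiff_ge (d := 2 * h + f) (fun b => G.Adj (i, u) (i - 1, b) ∧
          G.Adj (i + 2, y) (i + 3, b)) (F x) (by omega) (hF x)
        have h7 : 2 * h ≤ (Finset.univ.filter (fun b => (G.Adj (i, u) (i - 1, b) ∧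
          G.Adj (i + 2, y) (i + 3, b)) ∧ b ∉ F x)).card := by omega
        refine h7.trans (Finset.card_le_card ?_)
        intro b hb
        simp only [Finset.mem_filter, Finset.mem_univ, true_and] at hb
        simp only [hYdef, Finset.mem_filter, Finset.mem_univ, true_and]
        exact ⟨fun h => absurd h hxi, fun _ => hb.2, fun h => absurd h hx1,
          fun _ => hb.1.1, fun _ => hb.1.2⟩
      · have h6 := card_sdiff_ge _ (F x) hN3 (hF x)
        refine (show 2 * h ≤ _ by omega : 2 * h ≤ _).trans (Finset.card_le_card (s := Finset.univ.filter
          (fun b => G.Adj (i + 2, y) (i + 3, b) ∧ b ∉ F x)) ?_)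
        intro b hb
        simp only [Finset.mem_filter, Finset.mem_univ, true_and] at hb
        simp only [hYdef, Finset.mem_filter, Finset.mem_univ, true_and]
        exact ⟨fun h => absurd h hxi, fun _ => hb.2, fun h => absurd h hx1,
          fun h => absurd h hxm, fun _ => hb.1⟩
    by_cases hxm : x = i - 1
    · have h6 := card_sdiff_ge _ (F x) (hdm i u) (hF x)
      refine (show 2 * h ≤ _ by omega : 2 * h ≤ _).trans (Finset.card_le_card (s := Finset.univ.filter
          (fun b => G.Adj (i, u) (i - 1, b) ∧ b ∉ F x)) ?_)
      intro b hb
      simp only [Finset.mem_filter, Finset.mem_univ, true_and] at hb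
      simp only [hYdef, Finset.mem_filter, Finset.mem_univ, true_and]
      exact ⟨fun h => absurd h hxi, fun _ => hb.2, fun h => absurd h hx1,
          fun _ => hb.1, fun h => absurd h hx3⟩
    · have h6 := card_sdiff_ge (d := n) (fun _ => True) (F x) (by simp) (hF x)
      refine (show 2 * h ≤ _ by omega : 2 * h ≤ _).trans (Finset.card_le_card (s := Finset.univ.filter
          (fun b => True ∧ b ∉ F x)) ?_)
      intro b hb
      simp only [Finset.mem_filter, Finset.mem_univ, true_and] at hb
      simp only [hYdef, Finset.mem_filter, Finset.mem_univ, true_and]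
      exact ⟨fun h => absurd h hxi, fun _ => hb, fun h => absurd h hx1,
          fun h => absurd h hxm, fun h => absurd h hx3⟩
  obtain ⟨c, hc, hcs, hcY⟩ := cycle_aux hk hh G hole (i + 2) y Y hYc
    (by
      intro b hb
      rw [show i + 2 + 1 = i + 3 by ring] at hb ⊢
      simp only [hYdef, Finset.mem_filter, Finset.mem_univ, true_and] at hb
      exact hb.2.2.2.2 (by trivial))
    (by
      intro b hb
      rw [show i + 2 - 1 = i + 1 by ring] at hb ⊢
      simp only [hYdef, Finset.mem_filter, Finset.mem_univ, true_and] at hb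
      exact (hb.2.2.1 (by trivial)).2)
  simp only [hYdef, Finset.mem_filter, Finset.mem_univ, true_and] at hcY
  refine ⟨c, hc, (hcY i e6.symm).1 rfl, ?_, ((hcY (i + 1) e7.symm).2.2.1 rfl).1,
    (hcY (i - 1) e8.symm).2.2.2.1 rfl⟩
  intro x hx
  by_cases hx2 : x = i + 2
  · subst hx2
    rw [hcs]
    exact hyF
  · exact (hcY x hx2).2.1 hx

lemma factor_two {k n : ℕ} (G : SimpleGraph (ZMod k × Fin n)) (c c' : ZMod k → Fin n)
    (hc : ∀ x, G.Adj (x, c x) (x + 1, c (x + 1)))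
    (hc' : ∀ x, G.Adj (x, c' x) (x + 1, c' (x + 1))) (hne : ∀ x, c x ≠ c' x)
    (A : Set (ZMod k × Fin n)) (hA : ∀ x a, (x, a) ∈ A ↔ a = c x ∨ a = c' x) :
    HasTransversalCkFactorOn G A := by
  refine ⟨2, ![c, c'], ?_, ?_, ?_⟩
  · intro j x
    fin_cases j
    · exact hc x
    · exact hc' x
  · intro x j j' h
    fin_cases j <;> fin_cases j' <;> first | rfl | skip
    · exact absurd h (hne x)
    · exact absurd h.symm (hne x)
  · intro x
    ext a
    simp only [Set.mem_range, Set.mem_setOf_eq, hA, Fin.exists_fin_two]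
    simp [eq_comm]

lemma update_cycle {k n : ℕ} (hk : 4 ≤ k) (G : SimpleGraph (ZMod k × Fin n)) (c : ZMod k → Fin n)
    (hc : ∀ x, G.Adj (x, c x) (x + 1, c (x + 1))) (i : ZMod k) (u : Fin n)
    (h1 : G.Adj (i, u) (i + 1, c (i + 1))) (h2 : G.Adj (i, u) (i - 1, c (i - 1))) (x : ZMod k) :
    G.Adj (x, Function.update c i u x) (x + 1, Function.update c i u (x + 1)) := by
  have n1 : (1 : ZMod k) ≠ 0 := by simpa using zmod_ne (k := k) (m := 1) (by omega) (by omega)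
  by_cases hx : x = i
  · subst hx
    have : x + 1 ≠ x := by simpa using n1
    rw [Function.update_self, Function.update_of_ne this]
    exact h1
  · by_cases hx' : x + 1 = i
    · subst hx'
      rw [Function.update_self, Function.update_of_ne hx]
      rw [add_sub_cancel_right] at h2
      exact h2.symm
    · rw [Function.update_of_ne hx, Function.update_of_ne hx']
      exact hc x

open Classical in
lemma core {k n h d f : ℕ} (hk : 4 ≤ k) (hh : 1 ≤ h) (G : SimpleGraph (ZMod k × Fin n))
    (hole : ∀ (i : ZMod k) (S T : Finset (Fin n)), h ≤ S.card → h ≤ T.card →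
      ∃ a ∈ S, ∃ b ∈ T, G.Adj (i, a) (i + 1, b))
    (hdp : ∀ (i : ZMod k) (a : Fin n),
      d ≤ (Finset.univ.filter (fun b => G.Adj (i, a) (i + 1, b))).card)
    (hdm : ∀ (i : ZMod k) (a : Fin n),
      d ≤ (Finset.univ.filter (fun b => G.Adj (i, a) (i - 1, b))).card)
    (hfd : f + 2 * h ≤ d) (hk4 : k = 4 → n + f + 2 * h ≤ 2 * d)
    (havg : n * (2 * h) < (d - f) * (d - f))
    (i : ZMod k) (u v : Fin n) (W : Set (ZMod k × Fin n)) (hW : W.ncard + 2 + 2 * h ≤ f) :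
    ∃ S : Set (ZMod k × Fin n),
      Disjoint S W ∧ S.ncard ≤ 2 * k - 1 ∧
      HasTransversalCkFactorOn G (insert ((i, u) : ZMod k × Fin n) S) ∧
      HasTransversalCkFactorOn G (insert ((i, v) : ZMod k × Fin n) S) := by
  have : NeZero k := ⟨by omega⟩
  have hdn : d ≤ n := (hdp i u).trans ((Finset.card_le_univ _).trans (by simp))
  set F0 : ZMod k → Finset (Fin n) :=
    fun x => Finset.univ.filter (fun a => (x, a) ∈ W) ∪ {u, v} with hF0
  have hF0c : ∀ x, (F0 x).card ≤ W.ncard + 2 := by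
    intro x
    refine (Finset.card_union_le _ _).trans (Nat.add_le_add ?_ Finset.card_le_two)
    rw [← Set.ncard_coe_finset]
    refine Set.ncard_le_ncard_of_injOn (fun a => (x, a)) ?_ ?_ (Set.toFinite W)
    · intro a ha
      simpa using ha
    · intro a _ b _ hab
      simpa using hab
  have hcol : ∀ M ≤ 2 * h, ∃ (X : Finset (Fin n)) (D : ZMod k → Finset (Fin n)),
      X.card = M ∧ (∀ x, (D x).card ≤ M) ∧ (∀ w ∈ X, w ∉ F0 i) ∧
      ∀ w ∈ X, ∃ c : ZMod k → Fin n, (∀ x, G.Adj (x, c x) (x + 1, c (x + 1))) ∧ c i = w ∧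
        (∀ x, x ≠ i → c x ∉ F0 x ∧ c x ∈ D x) ∧ G.Adj (i, u) (i + 1, c (i + 1)) ∧
        G.Adj (i, u) (i - 1, c (i - 1)) := by
    intro M
    induction M with
    | zero =>
      intro _
      exact ⟨∅, fun _ => ∅, by simp, by simp, by simp, by simp⟩
    | succ M ih =>
      intro hM
      obtain ⟨X, D, hXc, hDc, hXF, hX⟩ := ih (by omega)
      have h6 := card_sdiff_ge (d := n) (f := f) (fun _ => True) (F0 i ∪ X) (by simp) (by
        refine (Finset.card_union_le _ _).trans ?_
        have := hF0c i
        omega)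
      obtain ⟨c, hc, hci, hcF, hu1, hu2⟩ := key_cycle hk hh G hole hdp hdm hfd hk4 havg i u
        (Finset.univ.filter (fun b => True ∧ b ∉ F0 i ∪ X)) (by omega) F0
        (fun j => by have := hF0c j; omega)
      simp only [Finset.mem_filter, Finset.mem_univ, true_and, Finset.mem_union, not_or] at hci
      refine ⟨insert (c i) X, fun x => insert (c x) (D x), ?_, ?_, ?_, ?_⟩
      · rw [Finset.card_insert_of_notMem hci.2, hXc]
      · intro x
        exact (Finset.card_insert_le _ _).trans (by have := hDc x; omega)
      · intro w hw
        rcases Finset.mem_insert.mp hw with rfl | hw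
        · exact hci.1
        · exact hXF w hw
      · intro w hw
        rcases Finset.mem_insert.mp hw with rfl | hw
        · exact ⟨c, hc, rfl, fun x hx => ⟨hcF x hx, Finset.mem_insert_self _ _⟩, hu1, hu2⟩
        · obtain ⟨c', g1, g2, g3, g4⟩ := hX w hw
          exact ⟨c', g1, g2, fun x hx => ⟨(g3 x hx).1, Finset.mem_insert_of_mem (g3 x hx).2⟩, g4⟩
  obtain ⟨X, D, hXc, hDc, hXF, hX⟩ := hcol (2 * h) le_rfl
  obtain ⟨c', hc', hci', hcF', hv1, hv2⟩ := key_cycle hk hh G hole hdp hdm hfd hk4 havg i v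
    X hXc.ge (fun x => F0 x ∪ D x) (fun x => by
      refine (Finset.card_union_le _ _).trans ?_
      have := hF0c x
      have := hDc x
      omega)
  obtain ⟨c, hc, hci, hcF, hu1, hu2⟩ := hX _ hci'
  have hwF := hXF _ hci'
  have hF0m : ∀ x a, a ∉ F0 x → (x, a) ∉ W ∧ a ≠ u ∧ a ≠ v := by
    intro x a ha
    have : ¬a = u ∧ ¬a = v ∧ (x, a) ∉ W := by simpa [hF0] using ha
    exact ⟨this.2.2, this.1, this.2.1⟩
  have hcc : ∀ x, x ≠ i → c x ≠ c' x := by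
    intro x hx he
    apply hcF' x hx
    rw [← he]
    exact Finset.mem_union_right _ (hcF x hx).2
  have hcW : ∀ x, (x, c x) ∉ W := by
    intro x
    by_cases hx : x = i
    · subst hx
      rw [hci]
      exact (hF0m _ _ hwF).1
    · exact (hF0m _ _ (hcF x hx).1).1
  have hcW' : ∀ x, (x, c' x) ∉ W := by
    intro x
    by_cases hx : x = i
    · subst hx
      exact (hF0m _ _ hwF).1
    · exact (hF0m _ _ (fun h => hcF' x hx (Finset.mem_union_left _ h))).1
  obtain ⟨-, hwu, hwv⟩ := hF0m _ _ hwF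
  have hkc : Fintype.card (ZMod k) = k := ZMod.card k
  refine ⟨(Set.range (fun x => (x, c x))) ∪ (Set.range (fun x => (x, c' x))), ?_, ?_, ?_, ?_⟩
  · rw [Set.disjoint_left]
    rintro _ (⟨x, rfl⟩ | ⟨x, rfl⟩)
    · exact hcW x
    · exact hcW' x
  · have h1 := Set.ncard_union_add_ncard_inter (Set.range (fun x => (x, c x)))
      (Set.range (fun x => (x, c' x)))
    have h2 : 0 < ((Set.range (fun x => (x, c x))) ∩ (Set.range (fun x => (x, c' x)))).ncard := by
      rw [Set.ncard_pos]
      exact ⟨(i, c' i), ⟨i, by simp [hci]⟩, ⟨i, rfl⟩⟩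
    have h3 : ∀ g : ZMod k → Fin n, (Set.range (fun x => (x, g x))).ncard ≤ k := by
      intro g
      rw [← Set.image_univ]
      refine (Set.ncard_image_le).trans ?_
      rw [Set.ncard_univ, Nat.card_eq_fintype_card, hkc]
    have := h3 c
    have := h3 c'
    omega
  · refine factor_two G (Function.update c i u) c' (update_cycle hk G c hc i u hu1 hu2) hc' ?_ _ ?_
    · intro x
      by_cases hx : x = i
      · subst hx
        rw [Function.update_self]
        exact hwu.symm
      · rw [Function.update_of_ne hx]
        exact hcc x hx
    · intro x a
      by_cases hx : x = i
      · subst hx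
        simp [hci, eq_comm]
      · have hx' : ¬ i = x := fun h => hx h.symm
        simp [hx, hx', eq_comm]
  · refine factor_two G (Function.update c' i v) c (update_cycle hk G c' hc' i v hv1 hv2) hc ?_ _ ?_
    · intro x
      by_cases hx : x = i
      · subst hx
        rw [Function.update_self, hci]
        exact hwv.symm
      · rw [Function.update_of_ne hx]
        exact (hcc x hx).symm
    · intro x a
      by_cases hx : x = i
      · subst hx
        simp [hci, eq_comm]
      · have hx' : ¬ i = x := fun h => hx h.symm
        simp [hx, hx', eq_comm, or_comm]

/-- **Claim (each part is closed).** Given an integer `k ≥ 4` and `δ > 2/k`, there exist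
`α, β > 0` such that for all sufficiently large `n`: if `G` is a spanning subgraph of the
`n`-blow-up of `C_k` with `δ̄(G) ≥ δn` and `α*_b(G) < αn`, then every part `V_i` is
`(C_k, βn, 2)`-closed: for any two vertices `u = (i, a)`, `v = (i, b)` of `V_i` and any vertex
set `W` with `|W| ≤ βn` there is a set `S ⊆ V(G) \ W` of size at most `2k − 1` such that both
`G[{u} ∪ S]` and `G[{v} ∪ S]` have transversal `C_k`-factors. -/
theorem parts_are_closed
    (k : ℕ) (hk : 4 ≤ k) (δ : ℝ) (hδ : 2 / k < δ) :
    ∃ α β : ℝ, 0 < α ∧ 0 < β ∧ ∃ n₀ : ℕ, ∀ n : ℕ, n₀ ≤ n →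
      ∀ G : SimpleGraph (ZMod k × Fin n),
        (∀ u v : ZMod k × Fin n, G.Adj u v → v.1 = u.1 + 1 ∨ u.1 = v.1 + 1) →
        (∀ (i : ZMod k) (a : Fin n),
          δ * n ≤ (({b : Fin n | G.Adj (i, a) (i + 1, b)}).ncard : ℝ) ∧
          δ * n ≤ (({b : Fin n | G.Adj (i, a) (i - 1, b)}).ncard : ℝ)) →
        (∀ (i : ZMod k) (S T : Finset (Fin n)), S.card = T.card →
          α * n ≤ (S.card : ℝ) → ∃ a ∈ S, ∃ b ∈ T, G.Adj (i, a) (i + 1, b)) →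
        ∀ (i : ZMod k) (a b : Fin n),
          ∀ W : Set (ZMod k × Fin n), (W.ncard : ℝ) ≤ β * n →
            ∃ S : Set (ZMod k × Fin n),
              Disjoint S W ∧ S.ncard ≤ 2 * k - 1 ∧
              HasTransversalCkFactorOn G (insert ((i, a) : ZMod k × Fin n) S) ∧
              HasTransversalCkFactorOn G (insert ((i, b) : ZMod k × Fin n) S) := by
  classical
  have hk0 : (0 : ℝ) < k := by exact_mod_cast (by omega : 0 < k)
  have hδ0 : 0 < δ := lt_trans (by positivity) hδ
  obtain ⟨ε, hε0, hε1, hεδ, hε4⟩ : ∃ ε : ℝ, 0 < ε ∧ ε ≤ 1 ∧ ε ≤ δ ∧ (k = 4 → ε ≤ 2 * δ - 1) := by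
    by_cases h4 : k = 4
    · subst h4
      norm_num at hδ
      exact ⟨min 1 (min δ (2 * δ - 1)), by
        refine lt_min one_pos (lt_min hδ0 (by linarith)), min_le_left _ _,
        (min_le_right _ _).trans (min_le_left _ _),
        fun _ => (min_le_right _ _).trans (min_le_right _ _)⟩
    · exact ⟨min 1 δ, lt_min one_pos hδ0, min_le_left _ _, min_le_right _ _, fun h => absurd h h4⟩
  refine ⟨ε ^ 2 / 40, ε / 10, by positivity, by positivity, ⌈40 / ε ^ 2⌉₊, ?_⟩
  intro n hn G _ hdeg hole i a b W hW
  have hn' : 40 / ε ^ 2 ≤ (n : ℝ) := (Nat.le_ceil _).trans (by exact_mod_cast hn)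
  have hεn2 : 40 ≤ ε ^ 2 * n := by
    rw [div_le_iff₀ (by positivity)] at hn'
    linarith
  have hnn : (0 : ℝ) ≤ n := Nat.cast_nonneg n
  have hsq : ε ^ 2 * n ≤ ε * n := by
    apply mul_le_mul_of_nonneg_right _ hnn
    nlinarith
  have hn0 : (0 : ℝ) < n := lt_of_lt_of_le (by positivity) hn'
  set h := ⌈ε ^ 2 / 40 * n⌉₊ with hh
  have hh1 : ε ^ 2 / 40 * n ≤ h := Nat.le_ceil _
  have hh2 : (h : ℝ) < ε ^ 2 / 40 * n + 1 := Nat.ceil_lt_add_one (by positivity)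
  have hh3 : (h : ℝ) ≤ ε ^ 2 * n / 20 := by linarith
  have hhpos : 1 ≤ h := by
    have : (0 : ℝ) < h := lt_of_lt_of_le (by positivity) hh1
    exact_mod_cast this
  set d := ⌈δ * n⌉₊ with hd
  have hd1 : δ * n ≤ d := Nat.le_ceil _
  set f := W.ncard + 2 + 2 * h with hf
  have hf1 : (f : ℝ) ≤ ε * n * (1 / 10 + 1 / 20 + 1 / 10) := by
    rw [hf]; push_cast; linarith
  have hεδn : ε * n ≤ δ * n := mul_le_mul_of_nonneg_right hεδ hnn
  have hfd : f + 2 * h ≤ d := by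
    have : (f : ℝ) + 2 * h ≤ d := by linarith
    exact_mod_cast this
  refine core (h := h) (d := d) (f := f) hk hhpos G ?_ ?_ ?_ hfd ?_ ?_ i a b W le_rfl
  · intro i S T hS hT
    obtain ⟨S', hS', hSc⟩ := Finset.exists_subset_card_eq hS
    obtain ⟨T', hT', hTc⟩ := Finset.exists_subset_card_eq hT
    obtain ⟨x, hx, y, hy, hxy⟩ := hole i S' T' (by rw [hSc, hTc]) (by rw [hSc]; exact hh1)
    exact ⟨x, hS' hx, y, hT' hy, hxy⟩
  · intro i a
    apply Nat.ceil_le.mpr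
    have := (hdeg i a).1
    rw [← Set.ncard_coe_finset]
    simpa using this
  · intro i a
    apply Nat.ceil_le.mpr
    have := (hdeg i a).2
    rw [← Set.ncard_coe_finset]
    simpa using this
  · intro h4
    have h5 := hε4 h4
    have h6 : ε * n ≤ (2 * δ - 1) * n := mul_le_mul_of_nonneg_right h5 hnn
    have : (n : ℝ) + f + 2 * h ≤ 2 * d := by linarith
    exact_mod_cast this
  · have hfd' : f ≤ d := by omega
    have h7 : ε * n / 2 ≤ ((d - f : ℕ) : ℝ) := by
      rw [Nat.cast_sub hfd']
      have := mul_pos hε0 hn0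
      linarith
    have h8 : (ε * n / 2) * (ε * n / 2) ≤ ((d - f : ℕ) : ℝ) * ((d - f : ℕ) : ℝ) :=
      mul_self_le_mul_self (by positivity) h7
    have h9 : (n : ℝ) * (2 * h) ≤ n * (2 * (ε ^ 2 * n / 20)) := by gcongr
    have h10 : (0 : ℝ) < (ε * n) * (ε * n) := by positivity
    have : (n : ℝ) * (2 * h) < ((d - f : ℕ) : ℝ) * ((d - f : ℕ) : ℝ) := by nlinarith
    exact_mod_cast this
end

section
/- For every ε > 0 there exists d₀ such that for every d ≥ d₀ there exists α > 0 such that the following holds for all sufficiently large m: every m-vertex graph H with minimum degree δ(H) ≥ (ε/2)m and bipartite independence number α*(H) < αm is an (m,d)-expander. -/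
/-- For every `ε > 0` there exists `d₀` such that for every `d ≥ d₀` there exists `α > 0` such
that for all sufficiently large `m`: every `m`-vertex graph `H` with minimum degree at least
`(ε/2)m` and bipartite independence number `α*(H) < αm` (an edge between any two disjoint
equal-size sets of size at least `αm`) is an `(m,d)`-expander, i.e.,
(1) `|N_H(X)| ≥ d|X|` for all `X` with `1 ≤ |X| < ⌈m/(2d)⌉`, and
(2) there is an edge between any two disjoint sets of size `⌈m/(2d)⌉`. -/
theorem min_degree_small_bipartite_hole_implies_expander
    (ε : ℝ) (hε : 0 < ε) :
    ∃ d₀ : ℝ, ∀ d : ℝ, d₀ ≤ d → ∃ α : ℝ, 0 < α ∧ ∃ m₀ : ℕ, ∀ m : ℕ, m₀ ≤ m →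
      ∀ H : SimpleGraph (Fin m),
        (∀ v, ε / 2 * m ≤ ((H.neighborSet v).ncard : ℝ)) →
        (∀ S T : Finset (Fin m), Disjoint S T → S.card = T.card →
          α * m ≤ (S.card : ℝ) → ∃ s ∈ S, ∃ t ∈ T, H.Adj s t) →
        (∀ X : Set (Fin m), 1 ≤ X.ncard → X.ncard < ⌈(m : ℝ) / (2 * d)⌉₊ →
          d * X.ncard ≤ (({v : Fin m | v ∉ X ∧ ∃ u ∈ X, H.Adj u v}).ncard : ℝ)) ∧
        (∀ X Y : Set (Fin m), Disjoint X Y → X.ncard = ⌈(m : ℝ) / (2 * d)⌉₊ →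
          Y.ncard = ⌈(m : ℝ) / (2 * d)⌉₊ → ∃ x ∈ X, ∃ y ∈ Y, H.Adj x y) := by
  classical
  refine ⟨4, fun d hd => ?_⟩
  have hd1 : 0 < d + 1 := by linarith
  have hpos : 0 < min (1 / (2 * (d + 1))) (ε / (2 * (d + 1))) :=
    lt_min (by positivity) (by positivity)
  obtain ⟨α, hα0, hα1, hα2⟩ : ∃ α : ℝ, 0 < α ∧ α ≤ 1 / (2 * (d + 1)) ∧ α ≤ ε / (2 * (d + 1)) :=
    ⟨_, hpos, min_le_left _ _, min_le_right _ _⟩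
  rw [le_div_iff₀ (by positivity)] at hα1 hα2
  refine ⟨α, hα0, 8, fun m hm H hdeg hhole => ⟨?_, ?_⟩⟩
  · intro X hX1 hX2
    have hm' : (8 : ℝ) ≤ m := by exact_mod_cast hm
    set N : Set (Fin m) := {v : Fin m | v ∉ X ∧ ∃ u ∈ X, H.Adj u v} with hN
    have hXlt : (X.ncard : ℝ) < m / (2 * d) := Nat.lt_ceil.mp hX2
    rw [lt_div_iff₀ (by linarith)] at hXlt
    by_cases hcase : ⌈α * m⌉₊ ≤ X.ncard
    · by_contra hlt
      push Not at hlt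
      have hk : (⌈α * m⌉₊ : ℝ) < α * m + 1 := Nat.ceil_lt_add_one (by positivity)
      have hXN : (X ∪ N).ncard ≤ X.ncard + N.ncard := Set.ncard_union_le X N
      have hc : (X ∪ N).ncard + (X ∪ N)ᶜ.ncard = m := by
        have := Set.ncard_add_ncard_compl (X ∪ N)
        simpa using this
      have hα10 : α ≤ 1 / 10 := by nlinarith
      have hαm : α * m ≤ m / 10 := by nlinarith
      have hX4 : (X.ncard : ℝ) ≤ m / 8 := by
        have : (0 : ℝ) ≤ X.ncard := by positivity
        nlinarith
      have hrest : ⌈α * m⌉₊ ≤ (X ∪ N)ᶜ.ncard := by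
        have h1 : ((X ∪ N).ncard : ℝ) ≤ X.ncard + N.ncard := by exact_mod_cast hXN
        have h2 : ((X ∪ N).ncard : ℝ) + ((X ∪ N)ᶜ.ncard : ℝ) = m := by exact_mod_cast hc
        have h3 : (⌈α * m⌉₊ : ℝ) ≤ ((X ∪ N)ᶜ.ncard : ℝ) := by nlinarith
        exact_mod_cast h3
      rw [Set.ncard_eq_toFinset_card'] at hcase hrest
      obtain ⟨S, hS, hSc⟩ := Finset.exists_subset_card_eq hcase
      obtain ⟨T, hT, hTc⟩ := Finset.exists_subset_card_eq hrest
      have hSX : ∀ s ∈ S, s ∈ X := fun s hs => by simpa using hS hs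
      have hTX : ∀ t ∈ T, t ∉ X ∪ N := fun t ht => by
        have := hT ht
        rwa [Set.mem_toFinset] at this
      obtain ⟨s, hs, t, ht, hst⟩ := hhole S T
        (Finset.disjoint_left.mpr fun a ha hb => hTX a hb (Or.inl (hSX a ha)))
        (hSc.trans hTc.symm) (by rw [hSc]; exact Nat.le_ceil _)
      have htX : t ∉ X := fun h => hTX t ht (Or.inl h)
      exact hTX t ht (Or.inr ⟨htX, s, hSX s hs, hst⟩)
    · push Not at hcase
      have hlt : (X.ncard : ℝ) < α * m := Nat.lt_ceil.mp hcase
      obtain ⟨x, hx⟩ : X.Nonempty := by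
        rw [← Set.ncard_pos]; omega
      have hsub : H.neighborSet x ⊆ X ∪ N := by
        intro v hv
        by_cases hvX : v ∈ X
        · exact Or.inl hvX
        · exact Or.inr ⟨hvX, x, hx, hv⟩
      have h1 : (H.neighborSet x).ncard ≤ X.ncard + N.ncard :=
        (Set.ncard_le_ncard hsub).trans (Set.ncard_union_le X N)
      have h1' : ((H.neighborSet x).ncard : ℝ) ≤ X.ncard + N.ncard := by exact_mod_cast h1
      have h2 := hdeg x
      have h3 : (d + 1) * X.ncard ≤ (d + 1) * (α * m) := by gcongr
      have h4 : α * (2 * (d + 1)) * m ≤ ε * m := by gcongr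
      nlinarith
  · intro X Y hXY hX hY
    have hle : α * m ≤ (⌈(m : ℝ) / (2 * d)⌉₊ : ℝ) := by
      refine le_trans ?_ (Nat.le_ceil _)
      rw [le_div_iff₀ (by linarith)]
      have : α * (2 * d) ≤ 1 := by nlinarith
      have hm0 : (0 : ℝ) ≤ m := by positivity
      nlinarith
    rw [Set.ncard_eq_toFinset_card'] at hX hY
    obtain ⟨s, hs, t, ht, hst⟩ := hhole X.toFinset Y.toFinset
      (Set.disjoint_toFinset.mpr hXY) (hX.trans hY.symm) (by rw [hX]; exact hle)
    exact ⟨s, by simpa using hs, t, by simpa using ht, hst⟩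
end
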